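/- arXiv:1604.02067 — 2 statements merged into one kernel-verified Lean document; each statement's English description precedes it below -/
import Mathlib

section
/- Let k be an algebraically closed field and let m ≥ 2, n ≥ 4, and 1 ≤ h ≤ n − 3 be integers; if m > 2, assume that k has characteristic 0 or characteristic greater than n. Let I_{m,n,h} be the ideal of k[z_{i,j} : 1 ≤ i ≤ m, 1 ≤ j ≤ n] generated by e_n^j(z_{1,1}, …, z_{1,n}) − e_n^j(z_{i,1}, …, z_{i,n}) for 2 ≤ i ≤ m and 1 ≤ j ≤ n − h − 1. Then the zero locus of I_{m,n,h} in the prime spectrum of k[z_{i,j}] is an irreducible closed set; equivalently, the radical of I_{m,n,h} is a prime ideal. -/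
open Pointwise in
/-- An invariant ideal `I` has prime radical if it is contained in primes `P i` each of which has a
translate inside every prime containing `I`, and whose stabilizers together generate the group. -/
theorem Ideal.radical_isPrime_of_iSup_stabilizer_eq_top {G S ι : Type*} [Group G] [CommRing S]
    [MulSemiringAction G S] [Nonempty ι] (N : ι → Subgroup G) [∀ i, (N i).Normal]
    (hN : ⨆ i, N i = ⊤) {I : Ideal S} (hI : ∀ g : G, g • I = I) (P : ι → Ideal S)
    (hP : ∀ i, (P i).IsPrime) (hIP : ∀ i, I ≤ P i)
    (hdom : ∀ i, ∀ Q : Ideal S, Q.IsPrime → I ≤ Q → ∃ g : G, g • P i ≤ Q)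
    (hstab : ∀ i, ∀ g ∈ N i, g • P i = P i) : I.radical.IsPrime := by
  have conj (i : ι) (Q : Ideal S) (hQ : Q ∈ I.minimalPrimes) : ∃ g : G, g • P i = Q := by
    obtain ⟨g, hg⟩ := hdom i Q hQ.1.1 hQ.1.2
    have := hP i
    refine ⟨g, le_antisymm hg (hQ.2 ⟨inferInstance, ?_⟩ hg)⟩
    rw [Ideal.subset_pointwise_smul_iff, hI]
    exact hIP i
  have stab (Q : Ideal S) (hQ : Q ∈ I.minimalPrimes) (g : G) : g • Q = Q := by
    have h : (⊤ : Subgroup G) ≤ MulAction.stabilizer G Q := by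
      rw [← hN, iSup_le_iff]
      intro i x hx
      obtain ⟨c, rfl⟩ := conj i Q hQ
      have := hstab i _ (Subgroup.Normal.conj_mem inferInstance x hx c⁻¹)
      rw [MulAction.mem_stabilizer_iff]
      rw [inv_inv, mul_smul, mul_smul, inv_smul_eq_iff] at this
      exact this
    exact h (Subgroup.mem_top g)
  obtain ⟨i⟩ := ‹Nonempty ι›
  have := hP i
  obtain ⟨Q, hQ, -⟩ := Ideal.exists_minimalPrimes_le (hIP i)
  have huniq : I.minimalPrimes = {Q} := by
    refine Set.eq_singleton_iff_unique_mem.2 ⟨hQ, fun Q' hQ' ↦ ?_⟩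
    obtain ⟨g, rfl⟩ := conj i Q hQ
    obtain ⟨g', rfl⟩ := conj i Q' hQ'
    rw [← stab _ hQ (g' * g⁻¹), mul_smul, inv_smul_smul]
  rw [← Ideal.sInf_minimalPrimes, huniq, sInf_singleton]
  exact hQ.1.1

/-- A homomorphism to an algebraically closed field extends along an integral extension. -/
theorem IsAlgClosed.exists_ringHom_extension {A C F : Type*} [CommRing A] [CommRing C]
    [Algebra A C] [Algebra.IsIntegral A C] [FaithfulSMul A C] [Field F] [IsAlgClosed F]
    (κ : A →+* F) : ∃ χ : C →+* F, χ.comp (algebraMap A C) = κ := by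
  have := RingHom.ker_isPrime κ
  obtain ⟨Q, -, hQ, hQκ⟩ := Ideal.exists_ideal_over_prime_of_isIntegral (S := C)
    (RingHom.ker κ) ⊥ (by
      rw [← RingHom.ker_eq_comap_bot, (RingHom.injective_iff_ker_eq_bot _).1
        (FaithfulSMul.algebraMap_injective A C)]
      exact bot_le)
  let κ' : A ⧸ Q.comap (algebraMap A C) →+* F :=
    Ideal.Quotient.lift _ κ fun a ha ↦ by rwa [hQκ] at ha
  have hκ' : Function.Injective κ' :=
    RingHom.lift_injective_of_ker_le_ideal _ _ hQκ.ge
  let := κ'.toAlgebra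
  have : Module.IsTorsionFree (A ⧸ Q.comap (algebraMap A C)) F :=
    Module.isTorsionFree_iff_algebraMap_injective.2 hκ'
  have : Module.IsTorsionFree (A ⧸ Q.comap (algebraMap A C)) (C ⧸ Q) :=
    Module.isTorsionFree_iff_algebraMap_injective.2 Ideal.algebraMap_quotient_injective
  let l : C ⧸ Q →ₐ[A ⧸ Q.comap (algebraMap A C)] F := IsAlgClosed.lift
  refine ⟨(l : C ⧸ Q →+* F).comp (Ideal.Quotient.mk Q), RingHom.ext fun a ↦ ?_⟩
  exact l.commutes (Ideal.Quotient.mk _ a)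

open Polynomial in
/-- Two factorizations into monic linear factors agree up to a permutation. -/
theorem exists_perm_of_prod_X_sub_C_eq {N F : Type*} [Fintype N] [CommRing F] [IsDomain F]
    {a b : N → F} (hab : ∏ l, (X - C (a l)) = ∏ l, (X - C (b l))) :
    ∃ g : Equiv.Perm N, ∀ l, a (g l) = b l := by
  classical
  have h : Finset.univ.val.map a = Finset.univ.val.map b := by
    have key (c : N → F) : (∏ l, (X - C (c l))).roots = Finset.univ.val.map c := by
      rw [← roots_multiset_prod_X_sub_C (Finset.univ.val.map c), Multiset.map_map]
      rfl
    rw [← key a, ← key b, hab]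
  have e (c : F) : Nonempty ({l // b l = c} ≃ {l // a l = c}) := by
    refine ⟨Fintype.equivOfCardEq ?_⟩
    have := congrArg (Multiset.count c) h
    simp only [Multiset.count_map] at this
    simp only [Fintype.card_subtype, Finset.card, Finset.filter_val]
    simpa [eq_comm] using this.symm
  exact ⟨Equiv.ofFiberEquiv fun c ↦ (e c).some, fun l ↦ Equiv.ofFiberEquiv_map _ l⟩

open Polynomial in
theorem exists_prod_X_sub_C_eq {F : Type*} [Field F] [IsAlgClosed F] {n : ℕ} {f : F[X]}
    (hf : f.Monic) (hn : f.natDegree = n) : ∃ w : Fin n → F, ∏ l, (X - C (w l)) = f := by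
  have hs := IsAlgClosed.splits f
  have hc : f.roots.toList.length = n := by simp [← hs.natDegree_eq_card_roots, hn]
  subst hc
  refine ⟨f.roots.toList.get, ?_⟩
  have h := hs.eq_prod_roots
  rw [hf.leadingCoeff, C_1, one_mul] at h
  conv_rhs => rw [h]
  rw [← List.prod_ofFn, ← Multiset.coe_toList f.roots, Multiset.map_coe, Multiset.prod_coe]
  congr 1
  rw [Multiset.coe_toList]
  exact List.ofFn_getElem_eq_map f.roots.toList (fun x ↦ X - C x)

/-- A family integral over `A` and separable over the fraction field admits a polynomial over `A`
computing the trace of the product of the differences between its argument and the family. -/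
theorem exists_mvPolynomial_aeval_eq_sum_prod_sub {A K L Ω ι D : Type*} [CommRing A]
    [IsIntegrallyClosed A] [Field K] [Algebra A K] [IsFractionRing A K] [Field Ω] [Algebra K Ω]
    [Algebra A Ω] [IsScalarTower A K Ω] [Field L] [Algebra K L] [Algebra A L]
    [IsScalarTower A K L] [FiniteDimensional K L] [Algebra.IsSeparable K L] [IsAlgClosed Ω]
    (s : Finset D) (p : D → ι) (u : D → L)
    (hu : ∀ d, IsIntegral A (u d)) :
    ∃ E : MvPolynomial ι A, ∀ v : ι → Ω,
      MvPolynomial.aeval v E = ∑ σ : L →ₐ[K] Ω, ∏ d ∈ s, (v (p d) - σ (u d)) := by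
  let u' : D → integralClosure A L := fun d ↦ ⟨u d, hu d⟩
  let F : MvPolynomial ι (integralClosure A L) :=
    ∏ d ∈ s, (MvPolynomial.X (p d) - MvPolynomial.C (u' d))
  have ha (α : ι →₀ ℕ) :
      ∃ a : A, algebraMap A K a = Algebra.trace K L (MvPolynomial.coeff α F).val :=
    IsIntegrallyClosed.isIntegral_iff.1 (Algebra.isIntegral_trace (MvPolynomial.coeff α F).2)
  choose a ha using ha
  refine ⟨∑ α ∈ F.support, MvPolynomial.monomial α (a α), fun v ↦ ?_⟩
  have h (σ : L →ₐ[K] Ω) : ∏ d ∈ s, (v (p d) - σ (u d)) =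
      MvPolynomial.eval₂ ((σ : L →+* Ω).comp (integralClosure A L).val.toRingHom) v F := by
    simp only [F, MvPolynomial.eval₂_prod, MvPolynomial.eval₂_sub, MvPolynomial.eval₂_X,
      MvPolynomial.eval₂_C]
    rfl
  simp_rw [h, MvPolynomial.eval₂_eq, map_sum]
  rw [Finset.sum_comm]
  refine Finset.sum_congr rfl fun α _ ↦ ?_
  rw [MvPolynomial.aeval_monomial, IsScalarTower.algebraMap_apply A K Ω, ha,
    trace_eq_sum_embeddings Ω, Finset.sum_mul]
  rfl

open Polynomial in
/-- If the roots `w` of the polynomials `f j` stay distinct under a specialization of `A`, then the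
relations between them are preserved by each automorphism of `A` which fixes both the
polynomials and the specialization. -/
theorem aeval_map_eq_zero_of_separable_specialization {A K Ω F J N : Type*} [CommRing A]
    [IsDomain A] [IsIntegrallyClosed A] [Field K] [Algebra A K] [IsFractionRing A K] [Field Ω]
    [Algebra K Ω] [Algebra A Ω] [IsScalarTower A K Ω] [IsAlgClosure K Ω] [Field F]
    [IsAlgClosed F] [Fintype J] [Fintype N] {w : J → N → Ω} {f : J → A[X]}
    (hf : ∀ j, ∏ l, (X - C (w j l)) = (f j).map (algebraMap A Ω)) (α : A ≃+* A)
    (hα : ∀ j, (f j).map (α : A →+* A) = f j) (κ : A →+* F)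
    (hκα : κ.comp α = κ) (hκ : ∀ j, ((f j).map κ).Separable) {s : MvPolynomial (J × N) A}
    (hs : MvPolynomial.aeval (fun x ↦ w x.1 x.2) s = 0) :
    MvPolynomial.aeval (fun x ↦ w x.1 x.2) (MvPolynomial.map (α : A →+* A) s) = 0 := by
  classical
  have : IsAlgClosed Ω := IsAlgClosure.isAlgClosed K
  have hinj : Function.Injective (algebraMap A Ω) := by
    rw [IsScalarTower.algebraMap_eq A K Ω]
    exact (algebraMap K Ω).injective.comp (IsFractionRing.injective A K)
  have : FaithfulSMul A Ω := (faithfulSMul_iff_algebraMap_injective A Ω).2 hinj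
  have hroot (j : J) (l : N) : ((f j).map (algebraMap A Ω)).IsRoot (w j l) := by
    rw [← hf, IsRoot.def, eval_prod]
    exact Finset.prod_eq_zero (Finset.mem_univ l) (by simp)
  have hmonic (j : J) : (f j).Monic :=
    monic_of_injective hinj (by rw [← hf]; exact monic_prod_X_sub_C _ _)
  have hint (j : J) (l : N) : IsIntegral A (w j l) :=
    ⟨f j, hmonic j, by simpa [IsRoot.def, eval_map] using hroot j l⟩
  obtain ⟨χ, hχ⟩ := IsAlgClosed.exists_ringHom_extension (C := integralClosure A Ω) κ
  let w' : J → N → integralClosure A Ω := fun j l ↦ ⟨w j l, hint j l⟩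
  have hf' (j : J) : ∏ l, (X - C (w' j l)) = (f j).map (algebraMap A (integralClosure A Ω)) := by
    apply map_injective (algebraMap (integralClosure A Ω) Ω) Subtype.val_injective
    rw [map_map, ← IsScalarTower.algebraMap_eq, ← hf, Polynomial.map_prod]
    simp only [Polynomial.map_sub, map_X, map_C]
    rfl
  have hχw (j : J) : Function.Injective fun l ↦ χ (w' j l) := by
    rw [← separable_prod_X_sub_C_iff]
    have := congrArg (Polynomial.map χ) (hf' j)
    rw [map_map, hχ, Polynomial.map_prod] at this
    simp only [Polynomial.map_sub, map_X, map_C] at this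
    rw [this]
    exact hκ j
  have hw (j : J) : Function.Injective (w j) := by
    intro l l' h
    exact hχw j (congrArg χ (Subtype.ext h))
  have hsep (j : J) : ((f j).map (algebraMap A K)).Separable := by
    rw [← separable_map (algebraMap K Ω), map_map, ← IsScalarTower.algebraMap_eq, ← hf,
      separable_prod_X_sub_C_iff]
    exact hw j
  let S : Set Ω := Set.range fun x : J × N ↦ w x.1 x.2
  let L := IntermediateField.adjoin K S
  have : FiniteDimensional K L := by
    apply IntermediateField.finiteDimensional_adjoin
    rintro _ ⟨x, rfl⟩
    exact (hint x.1 x.2).tower_top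
  have : Algebra.IsSeparable K L := by
    rw [IntermediateField.isSeparable_adjoin_iff_isSeparable]
    rintro _ ⟨x, rfl⟩
    refine (hsep x.1).of_dvd (minpoly.dvd _ _ ?_)
    rw [aeval_def, eval₂_map, ← IsScalarTower.algebraMap_eq, ← eval_map]
    exact hroot x.1 x.2
  have hwL (j : J) (l : N) : w j l ∈ L := IntermediateField.subset_adjoin K S ⟨(j, l), rfl⟩
  let wL : J → N → L := fun j l ↦ ⟨w j l, hwL j l⟩
  have : IsScalarTower A L Ω := .of_algebraMap_eq fun _ ↦ rfl
  have hfL (j : J) : ∏ l, (X - C (wL j l)) = (f j).map (algebraMap A L) := by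
    apply map_injective (algebraMap L Ω) (algebraMap L Ω).injective
    rw [map_map, ← IsScalarTower.algebraMap_eq, ← hf, Polynomial.map_prod]
    simp only [Polynomial.map_sub, map_X, map_C]
    rfl
  let T : Finset (J × N × N) := Finset.univ.filter fun d ↦ d.2.1 ≠ d.2.2
  obtain ⟨E, hE⟩ := exists_mvPolynomial_aeval_eq_sum_prod_sub (A := A) (K := K) (Ω := Ω) T
    (fun d ↦ (d.1, d.2.1)) (fun d ↦ wL d.1 d.2.2) (fun d ↦ by
      rw [← isIntegral_algebraMap_iff (algebraMap L Ω).injective]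
      exact hint d.1 d.2.2)
  have hzero (v : J → N → Ω) (hv : ∀ j, ∏ l, (X - C (v j l)) = (f j).map (algebraMap A Ω))
      (σ : L →ₐ[K] Ω) (h : ¬ ∀ j l, σ (wL j l) = v j l) :
      ∏ d ∈ T, (v d.1 d.2.1 - σ (wL d.1 d.2.2)) = 0 := by
    push Not at h
    obtain ⟨j, l, hl⟩ := h
    have h1 : ∏ l, (X - C (σ (wL j l))) = ∏ l, (X - C (v j l)) := by
      have h2 := congrArg (Polynomial.map (σ : L →+* Ω)) (hfL j)
      rw [map_map, Polynomial.map_prod] at h2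
      simp only [Polynomial.map_sub, map_X, map_C] at h2
      rw [hv]
      refine h2.trans (congrArg (fun t ↦ Polynomial.map t (f j)) (RingHom.ext fun a ↦ ?_))
      rw [IsScalarTower.algebraMap_eq A K L, IsScalarTower.algebraMap_apply A K Ω]
      exact σ.commutes _
    obtain ⟨g, hg⟩ := exists_perm_of_prod_X_sub_C_eq h1
    refine Finset.prod_eq_zero (i := (j, l, g l)) ?_ (by simp [hg])
    rw [Finset.mem_filter]
    refine ⟨Finset.mem_univ _, fun h ↦ hl ?_⟩
    rw [← hg l]
    exact congrArg (fun t ↦ σ (wL j t)) h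
  let αK : K ≃+* K := IsFractionRing.ringEquivOfRingEquiv α
  let τ : Ω ≃+* Ω := IsAlgClosure.equivOfEquiv Ω Ω αK
  have hτ (a : A) : τ (algebraMap A Ω a) = algebraMap A Ω (α a) := by
    rw [IsScalarTower.algebraMap_apply A K Ω, IsAlgClosure.equivOfEquiv_algebraMap,
      IsFractionRing.ringEquivOfRingEquiv_algebraMap, ← IsScalarTower.algebraMap_apply]
  let v : J → N → Ω := fun j l ↦ τ.symm (w j l)
  have hτv (t : MvPolynomial (J × N) A) :
      MvPolynomial.aeval (fun x ↦ w x.1 x.2) (MvPolynomial.map (α : A →+* A) t) =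
        τ (MvPolynomial.aeval (fun x ↦ v x.1 x.2) t) := by
    induction t using MvPolynomial.induction_on with
    | C a => simp [hτ]
    | add p q hp hq => simp [hp, hq]
    | mul_X p i hp => simp [hp, v]
  have hv (j : J) : ∏ l, (X - C (v j l)) = (f j).map (algebraMap A Ω) := by
    apply map_injective (τ : Ω →+* Ω) τ.injective
    have : (τ : Ω →+* Ω).comp (algebraMap A Ω) = (algebraMap A Ω).comp (α : A →+* A) :=
      RingHom.ext hτ
    rw [map_map, this, ← map_map, hα, ← hf, Polynomial.map_prod]
    simp [v]
  rw [hτv, map_eq_zero_iff τ τ.injective]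
  by_cases hσ : ∃ σ : L →ₐ[K] Ω, ∀ j l, σ (wL j l) = v j l
  · obtain ⟨σ, hσ⟩ := hσ
    have h0 : MvPolynomial.aeval (fun x ↦ wL x.1 x.2) s = 0 := by
      apply (algebraMap L Ω).injective
      rw [map_zero, ← hs, ← MvPolynomial.aeval_algebraMap_apply]
      rfl
    have h1 := congrArg (σ.restrictScalars A) h0
    rw [map_zero, MvPolynomial.comp_aeval_apply] at h1
    convert! h1 using 3
    exact funext fun x ↦ (hσ x.1 x.2).symm
  · exfalso
    have hEv : MvPolynomial.aeval (fun x ↦ w x.1 x.2) (MvPolynomial.map (α : A →+* A) E) = 0 := by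
      rw [hτv, hE, Finset.sum_eq_zero, map_zero]
      exact fun σ _ ↦ hzero v hv σ fun h ↦ hσ ⟨σ, h⟩
    have hEw : MvPolynomial.aeval (fun x ↦ w x.1 x.2) E =
        ∏ d ∈ T, (w d.1 d.2.1 - w d.1 d.2.2) := by
      rw [hE, Finset.sum_eq_single L.val]
      · rfl
      · refine fun σ _ hne ↦ hzero w hf σ fun h ↦ hne ?_
        apply IntermediateField.algHom_ext_of_eq_adjoin K rfl
        rintro _ ⟨x, rfl⟩
        exact h x.1 x.2
      · simp
    have hv' (t : MvPolynomial (J × N) A) :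
        algebraMap (integralClosure A Ω) Ω (MvPolynomial.aeval (fun x ↦ w' x.1 x.2) t) =
          MvPolynomial.aeval (fun x ↦ w x.1 x.2) t := by
      rw [← MvPolynomial.aeval_algebraMap_apply]
      rfl
    have hχE (t : MvPolynomial (J × N) A) :
        χ (MvPolynomial.aeval (fun x ↦ w' x.1 x.2) (MvPolynomial.map (α : A →+* A) t)) =
          χ (MvPolynomial.aeval (fun x ↦ w' x.1 x.2) t) := by
      have h (a : A) : χ (algebraMap A _ (α a)) = χ (algebraMap A _ a) := by
        have h1 := RingHom.congr_fun hκα a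
        rw [← hχ] at h1
        exact h1
      induction t using MvPolynomial.induction_on with
      | C a => simpa using h a
      | add p q hp hq => simp only [map_add, hp, hq]
      | mul_X p i hp => simp only [map_mul, hp, MvPolynomial.map_X]
    have hE0 : MvPolynomial.aeval (fun x ↦ w' x.1 x.2) (MvPolynomial.map (α : A →+* A) E) = 0 := by
      apply Subtype.val_injective
      exact (hv' _).trans hEv
    have hE1 : MvPolynomial.aeval (fun x ↦ w' x.1 x.2) E =
        ∏ d ∈ T, (w' d.1 d.2.1 - w' d.1 d.2.2) := by
      apply FaithfulSMul.algebraMap_injective (integralClosure A Ω) Ω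
      rw [hv', hEw, map_prod]
      rfl
    have := hχE E
    rw [hE0, hE1, map_zero, map_prod, eq_comm, Finset.prod_eq_zero_iff] at this
    obtain ⟨d, hd, hd0⟩ := this
    rw [map_sub, sub_eq_zero] at hd0
    exact (Finset.mem_filter.1 hd).2 (hχw d.1 hd0)
open Polynomial in
/-- Relations between the roots `w` of the polynomials `f j` specialize to relations between the
roots `z` of their specializations, once the latter are suitably numbered. -/
theorem exists_perm_eval₂_eq_zero_of_specialization {A Ω F J N : Type*} [CommRing A] [Field Ω]
    [Algebra A Ω] [FaithfulSMul A Ω] [Field F] [IsAlgClosed F] [Fintype N] (κ : A →+* F)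
    {f : J → A[X]} {w : J → N → Ω} {z : J → N → F}
    (hw : ∀ j, ∏ l, (X - C (w j l)) = (f j).map (algebraMap A Ω))
    (hz : ∀ j, ∏ l, (X - C (z j l)) = (f j).map κ) :
    ∃ g : J → Equiv.Perm N, ∀ s : MvPolynomial (J × N) A,
      MvPolynomial.aeval (fun x ↦ w x.1 x.2) s = 0 →
        MvPolynomial.eval₂ κ (fun x ↦ z x.1 (g x.1 x.2)) s = 0 := by
  have hinj : Function.Injective (algebraMap A Ω) := FaithfulSMul.algebraMap_injective A Ω
  have hint (j : J) (l : N) : IsIntegral A (w j l) := by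
    refine ⟨f j, monic_of_injective hinj (by rw [← hw]; exact monic_prod_X_sub_C _ _), ?_⟩
    rw [← eval_map, ← hw, eval_prod]
    exact Finset.prod_eq_zero (Finset.mem_univ l) (by simp)
  have : FaithfulSMul A (integralClosure A Ω) :=
    (faithfulSMul_iff_algebraMap_injective _ _).2 (Function.Injective.of_comp
      (f := algebraMap (integralClosure A Ω) Ω) hinj)
  obtain ⟨χ, hχ⟩ := IsAlgClosed.exists_ringHom_extension (C := integralClosure A Ω) κ
  let w' : J → N → integralClosure A Ω := fun j l ↦ ⟨w j l, hint j l⟩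
  have hperm (j : J) : ∃ g : Equiv.Perm N, ∀ l, z j (g l) = χ (w' j l) := by
    apply exists_perm_of_prod_X_sub_C_eq
    have h : ∏ l, (X - C (w' j l)) = (f j).map (algebraMap A (integralClosure A Ω)) := by
      apply map_injective (algebraMap (integralClosure A Ω) Ω) Subtype.val_injective
      rw [map_map, ← IsScalarTower.algebraMap_eq, ← hw, Polynomial.map_prod]
      simp only [Polynomial.map_sub, map_X, map_C]
      rfl
    have := congrArg (Polynomial.map χ) h
    rw [map_map, hχ, ← hz, Polynomial.map_prod] at this
    simp only [Polynomial.map_sub, map_X, map_C] at this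
    exact this.symm
  choose g hg using hperm
  refine ⟨g, fun s hs ↦ ?_⟩
  have hs' : MvPolynomial.aeval (fun x ↦ w' x.1 x.2) s = 0 := by
    apply FaithfulSMul.algebraMap_injective (integralClosure A Ω) Ω
    rw [map_zero, ← hs, ← MvPolynomial.aeval_algebraMap_apply]
    rfl
  have := congrArg χ hs'
  rw [MvPolynomial.aeval_def, MvPolynomial.hom_eval₂, hχ, map_zero] at this
  simpa only [hg] using this

open Polynomial in
/-- Some polynomial of the form `X ^ n + r` with `r` of degree at most one is separable. -/
theorem Polynomial.exists_degree_lt_two_separable_X_pow_add {k : Type*} [Field k] {n : ℕ} :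
    ∃ r : k[X], r.degree < (2 : ℕ) ∧ (X ^ n + r).Separable := by
  by_cases hn : (n : k) = 0
  · refine ⟨X, by simp, ?_⟩
    rw [separable_def]
    have : derivative (X ^ n + X : k[X]) = 1 := by simp [derivative_X_pow, hn]
    rw [this]
    exact isCoprime_one_right
  · refine ⟨1, by simp, ?_⟩
    simpa using separable_X_pow_sub_C (-1 : k) hn (by simp)

open Polynomial in
theorem Polynomial.sum_fin_C_coeff_mul_X_pow {R : Type*} [CommRing R] {h : ℕ} {r : R[X]}
    (hr : r.degree < (h + 1 : ℕ)) : ∑ t : Fin (h + 1), C (r.coeff t) * X ^ (t : ℕ) = r := by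
  rw [Fin.sum_univ_eq_sum_range (fun t ↦ C (r.coeff t) * X ^ t)]
  refine (r.as_sum_range_C_mul_X_pow' ?_).symm
  rw [Nat.lt_succ_iff, natDegree_le_iff_coeff_eq_zero]
  exact fun d hd ↦ (degree_lt_iff_coeff_zero _ _).1 hr d hd

namespace ShortIntervals

variable {ι : Type*} {n h : ℕ}

/-- The ideal identifying the elementary symmetric polynomials of degrees `1, …, n - h - 1` of
all rows with those of the row `i₀`. -/
noncomputable def coneIdeal (k : Type*) [Field k] (n h : ℕ) (i₀ : ι) :
    Ideal (MvPolynomial (ι × Fin n) k) :=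
  Ideal.span {p | ∃ (i : ι) (j : ℕ), i ≠ i₀ ∧ 1 ≤ j ∧ j ≤ n - h - 1 ∧
    p = MvPolynomial.rename (Prod.mk i₀) (MvPolynomial.esymm (Fin n) k j) -
      MvPolynomial.rename (Prod.mk i) (MvPolynomial.esymm (Fin n) k j)}

/-- The permutation of the variables given by a permutation in each row. -/
def rowPerm (g : ι → Equiv.Perm (Fin n)) (x : ι × Fin n) : ι × Fin n := (x.1, g x.1 x.2)

/-- The monic polynomial whose roots are the entries of the row `i`. -/
noncomputable def rowPoly {R : Type*} [CommRing R] (z : ι × Fin n → R) (i : ι) : Polynomial R :=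
  ∏ l, (Polynomial.X - Polynomial.C (z (i, l)))

section
variable {k R : Type*} [Field k] [CommRing R] [Algebra k R]

theorem coeff_rowPoly (z : ι × Fin n → R) (i : ι) {d : ℕ} (hd : d ≤ n) :
    (rowPoly z i).coeff d = (-1) ^ (n - d) *
      MvPolynomial.aeval z (MvPolynomial.rename (Prod.mk i)
        (MvPolynomial.esymm (Fin n) k (n - d))) := by
  have h := Multiset.prod_X_sub_C_coeff (Finset.univ.val.map fun l ↦ z (i, l)) (k := d) (by simpa)
  rw [Multiset.map_map] at h
  rw [MvPolynomial.aeval_rename, MvPolynomial.aeval_esymm_eq_multiset_esymm]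
  simp only [Multiset.card_map, Finset.card_val, Finset.card_univ, Fintype.card_fin] at h
  exact h

theorem rowPoly_monic (z : ι × Fin n → R) (i : ι) : (rowPoly z i).Monic :=
  Polynomial.monic_prod_X_sub_C _ _

theorem natDegree_rowPoly [Nontrivial R] (z : ι × Fin n → R) (i : ι) :
    (rowPoly z i).natDegree = n :=
  (Polynomial.natDegree_finsetProd_X_sub_C_eq_card _ _).trans (by simp)

theorem coneIdeal_le_ker_iff [Nontrivial R] (i₀ : ι) (z : ι × Fin n → R) :
    coneIdeal k n h i₀ ≤ RingHom.ker (MvPolynomial.aeval (R := k) z) ↔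
      ∀ i, (rowPoly z i - rowPoly z i₀).degree < (h + 1 : ℕ) := by
  rw [coneIdeal, Ideal.span_le]
  constructor
  · intro H i
    rw [Polynomial.degree_lt_iff_coeff_zero]
    intro d hd
    rw [Polynomial.coeff_sub, sub_eq_zero]
    rcases lt_trichotomy d n with hdn | rfl | hdn
    · rw [coeff_rowPoly (k := k) _ _ hdn.le, coeff_rowPoly (k := k) _ _ hdn.le]
      rcases eq_or_ne i i₀ with rfl | hi
      · rfl
      · have := H ⟨i, n - d, hi, by omega, by omega, rfl⟩
        rw [SetLike.mem_coe, RingHom.mem_ker, map_sub, sub_eq_zero] at this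
        rw [this]
    · have h1 (j : ι) : (rowPoly z j).coeff d = 1 := by
        simpa [natDegree_rowPoly] using (rowPoly_monic z j).coeff_natDegree
      rw [h1, h1]
    · rw [Polynomial.coeff_eq_zero_of_natDegree_lt (by rwa [natDegree_rowPoly]),
        Polynomial.coeff_eq_zero_of_natDegree_lt (by rwa [natDegree_rowPoly])]
  · rintro H _ ⟨i, j, hi, hj1, hj2, rfl⟩
    rw [SetLike.mem_coe, RingHom.mem_ker, map_sub, sub_eq_zero]
    have h1 := (Polynomial.degree_lt_iff_coeff_zero _ _).1 (H i) (n - j) (by omega)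
    rw [Polynomial.coeff_sub, sub_eq_zero, coeff_rowPoly (k := k) _ _ (Nat.sub_le _ _),
      coeff_rowPoly (k := k) _ _ (Nat.sub_le _ _), Nat.sub_sub_self (by omega)] at h1
    exact ((isUnit_one.neg.pow j).mul_left_cancel h1).symm

end

theorem rename_rowPerm_mem_coneIdeal {k : Type*} [Field k] (i₀ : ι) (g : ι → Equiv.Perm (Fin n))
    {s : MvPolynomial (ι × Fin n) k} (hs : s ∈ coneIdeal k n h i₀) :
    MvPolynomial.rename (rowPerm g) s ∈ coneIdeal k n h i₀ := by
  suffices coneIdeal k n h i₀ ≤ (coneIdeal k n h i₀).comap (MvPolynomial.rename (rowPerm g)) from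
    this hs
  conv_lhs => rw [coneIdeal]
  rw [Ideal.span_le]
  rintro _ ⟨i, j, hi, hj1, hj2, rfl⟩
  have h1 (i : ι) : MvPolynomial.rename (rowPerm g) (MvPolynomial.rename (Prod.mk i)
      (MvPolynomial.esymm (Fin n) k j)) =
        MvPolynomial.rename (Prod.mk i) (MvPolynomial.esymm (Fin n) k j) := by
    conv_rhs => rw [← MvPolynomial.rename_esymm _ _ _ (g i)]
    rw [MvPolynomial.rename_rename, MvPolynomial.rename_rename]
    rfl
  rw [SetLike.mem_coe, Ideal.mem_comap, map_sub, h1, h1]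
  exact Ideal.subset_span ⟨i, j, hi, hj1, hj2, rfl⟩

/-- Permutations inside the rows act on the polynomial ring. -/
noncomputable abbrev rowPermAction (ι : Type*) (n : ℕ) (k : Type*) [Field k] :
    MulSemiringAction (ι → Equiv.Perm (Fin n)) (MvPolynomial (ι × Fin n) k) where
  smul g s := MvPolynomial.rename (rowPerm g) s
  one_smul s := MvPolynomial.rename_id_apply s
  mul_smul g g' s := (MvPolynomial.rename_rename (rowPerm g') (rowPerm g) s).symm
  smul_zero _ := map_zero _
  smul_add _ := map_add _
  smul_one _ := map_one _
  smul_mul _ := map_mul _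

/-- The coordinate ring of the space of a row together with a lower-order perturbation for
every row. -/
abbrev ParamRing (ι : Type*) (n h : ℕ) (k : Type*) [Field k] : Type _ :=
  MvPolynomial (Fin n ⊕ ι × Fin (h + 1)) k

/-- The generic polynomial of the row `j` when the roots of the row `i` are taken as parameters. -/
noncomputable def genericPoly [DecidableEq ι] (k : Type*) [Field k] (n h : ℕ) (i j : ι) :
    Polynomial (ParamRing ι n h k) :=
  ∏ l, (Polynomial.X - Polynomial.C (MvPolynomial.X (Sum.inl l))) +
    if j = i then 0 else
      ∑ t : Fin (h + 1), Polynomial.C (MvPolynomial.X (Sum.inr (j, t))) * Polynomial.X ^ (t : ℕ)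

section
variable [DecidableEq ι] {k : Type*} [Field k]

open Polynomial in
theorem degree_ite_sum_C_mul_X_pow_lt {A : Type*} [CommRing A] (c : Fin (h + 1) → A)
    (P : Prop) [Decidable P] :
    (if P then 0 else ∑ t : Fin (h + 1), C (c t) * X ^ (t : ℕ) : A[X]).degree < (h + 1 : ℕ) := by
  split_ifs
  · simp
  · exact degree_sum_fin_lt c

open Polynomial in
theorem degree_genericPoly_sub_lt (i j : ι) :
    (genericPoly k n h i j -
      ∏ l, (X - C (MvPolynomial.X (Sum.inl l)))).degree < (h + 1 : ℕ) := by
  rw [genericPoly, add_sub_cancel_left]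
  exact degree_ite_sum_C_mul_X_pow_lt _ _

open Polynomial in
theorem genericPoly_monic_natDegree (hn : h < n) (i j : ι) :
    (genericPoly k n h i j).Monic ∧ (genericPoly k n h i j).natDegree = n := by
  have h1 : (∏ l : Fin n, (X - C (MvPolynomial.X (Sum.inl l) : ParamRing ι n h k))).natDegree
      = n := (natDegree_finsetProd_X_sub_C_eq_card _ _).trans (by simp)
  have hm : (∏ l : Fin n, (X - C (MvPolynomial.X (Sum.inl l) : ParamRing ι n h k))).Monic :=
    monic_prod_X_sub_C _ _
  have h2 : (if j = i then 0 else ∑ t : Fin (h + 1),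
      C (MvPolynomial.X (Sum.inr (j, t)) : ParamRing ι n h k) * X ^ (t : ℕ)).degree <
      (∏ l : Fin n, (X - C (MvPolynomial.X (Sum.inl l) : ParamRing ι n h k))).degree := by
    rw [degree_eq_natDegree hm.ne_zero, h1]
    exact (degree_ite_sum_C_mul_X_pow_lt _ _).trans_le (by exact_mod_cast hn)
  exact ⟨hm.add_of_left h2, (natDegree_add_eq_left_of_degree_lt h2).trans h1⟩

open Polynomial in
theorem genericPoly_map {R : Type*} [CommRing R] (κ : ParamRing ι n h k →+* R) (i j : ι) :
    (genericPoly k n h i j).map κ = ∏ l, (X - C (κ (MvPolynomial.X (Sum.inl l)))) +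
      if j = i then 0 else
        ∑ t : Fin (h + 1), C (κ (MvPolynomial.X (Sum.inr (j, t)))) * X ^ (t : ℕ) := by
  rw [genericPoly, Polynomial.map_add, Polynomial.map_prod]
  split_ifs <;> simp [Polynomial.map_sum]

end

/-- A family in `Ω` consisting of the parameters in row `i` and of the roots of the generic
polynomials in the other rows. -/
structure IsGenericPoint [DecidableEq ι] (k : Type*) [Field k] {Ω : Type*} [CommRing Ω] (n h : ℕ)
    [Algebra (ParamRing ι n h k) Ω] (i : ι) (w : ι × Fin n → Ω) : Prop where
  rowPoly_eq (j : ι) : rowPoly w j =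
    (genericPoly k n h i j).map (algebraMap (ParamRing ι n h k) Ω)
  apply_eq (l : Fin n) : w (i, l) = algebraMap (ParamRing ι n h k) Ω (MvPolynomial.X (Sum.inl l))

section
variable [DecidableEq ι] {k A : Type*} [Field k] [CommRing A] [Algebra k A]

/-- The substitution of elements of `A` for the variables in row `i`. -/
noncomputable def substRow (i : ι) (y : Fin n → A) :
    MvPolynomial (ι × Fin n) k →ₐ[k] MvPolynomial ({j // j ≠ i} × Fin n) A :=
  MvPolynomial.aeval fun x ↦ if hx : x.1 ≠ i then MvPolynomial.X (⟨x.1, hx⟩, x.2) else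
    MvPolynomial.C (y x.2)

theorem aeval_substRow {Ω : Type*} [CommRing Ω] [Algebra A Ω] [Algebra k Ω] [IsScalarTower k A Ω]
    {i : ι} {y : Fin n → A} {w : ι × Fin n → Ω} (hw : ∀ l, w (i, l) = algebraMap A Ω (y l))
    (s : MvPolynomial (ι × Fin n) k) :
    MvPolynomial.aeval (fun x : {j // j ≠ i} × Fin n ↦ w (x.1, x.2)) (substRow i y s) =
      MvPolynomial.aeval w s := by
  rw [← AlgHom.restrictScalars_apply k, ← AlgHom.comp_apply]
  congr 1
  ext ⟨j, l⟩
  by_cases hj : j = i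
  · subst hj
    simp [substRow, hw]
  · simp [substRow, hj]

theorem map_substRow (α : A →ₐ[k] A) {i : ι} {y : Fin n → A} {π : Equiv.Perm (Fin n)}
    (hα : ∀ l, α (y l) = y (π l)) (s : MvPolynomial (ι × Fin n) k) :
    MvPolynomial.map (α : A →+* A) (substRow i y s) =
      substRow i y (MvPolynomial.rename (rowPerm (Pi.mulSingle i π)) s) := by
  suffices (MvPolynomial.mapAlgHom α).comp (substRow i y) =
      (substRow i y).comp (MvPolynomial.rename (rowPerm (Pi.mulSingle i π))) from
    AlgHom.congr_fun this s
  ext1 ⟨j, l⟩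
  by_cases hj : j = i
  · subst hj
    simp [substRow, rowPerm, hα]
  · simp [substRow, rowPerm, hj]

/-- If the roots in the rows other than `i` stay distinct under a specialization of `A`, then the
relations between the roots are stable under each permutation of the row `i` which is induced by
an automorphism of `A`. -/
theorem aeval_rename_rowPerm_mulSingle_eq_zero [Finite ι] [IsDomain A] [IsIntegrallyClosed A]
    {K Ω F : Type*} [Field K] [Algebra A K] [IsFractionRing A K] [Field Ω] [Algebra K Ω]
    [Algebra A Ω] [IsScalarTower A K Ω] [IsAlgClosure K Ω] [Algebra k Ω] [IsScalarTower k A Ω]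
    [Field F] [IsAlgClosed F] {i : ι} {w : ι × Fin n → Ω} {f : ι → Polynomial A}
    (hf : ∀ j, rowPoly w j = (f j).map (algebraMap A Ω)) {y : Fin n → A}
    (hy : ∀ l, w (i, l) = algebraMap A Ω (y l)) (α : A ≃ₐ[k] A) {π : Equiv.Perm (Fin n)}
    (hα : ∀ l, α (y l) = y (π l)) (hfα : ∀ j, j ≠ i → (f j).map (α : A →+* A) = f j)
    (κ : A →+* F) (hκα : ∀ a, κ (α a) = κ a) (hκ : ∀ j, j ≠ i → ((f j).map κ).Separable)
    {s : MvPolynomial (ι × Fin n) k} (hs : MvPolynomial.aeval w s = 0) :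
    MvPolynomial.aeval w (MvPolynomial.rename (rowPerm (Pi.mulSingle i π)) s) = 0 := by
  cases nonempty_fintype ι
  rw [← aeval_substRow hy, ← map_substRow (α : A →ₐ[k] A) hα]
  exact aeval_map_eq_zero_of_separable_specialization (K := K)
    (w := fun (j : {j // j ≠ i}) l ↦ w (j, l)) (f := fun j ↦ f j)
    (fun j ↦ hf j) (α : A ≃+* A) (fun j ↦ hfα j j.2) κ (RingHom.ext hκα) (fun j ↦ hκ j j.2)
    ((aeval_substRow hy s).trans hs)

end

section
variable [DecidableEq ι] {k Ω : Type*} [Field k] [Field Ω] [Algebra (ParamRing ι n h k) Ω]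

theorem exists_isGenericPoint [IsAlgClosed Ω] (hn : h < n) (i : ι) :
    ∃ w : ι × Fin n → Ω, IsGenericPoint k n h i w := by
  have (j : ι) : ∃ v : Fin n → Ω,
      ∏ l, (Polynomial.X - Polynomial.C (v l)) =
        (genericPoly k n h i j).map (algebraMap (ParamRing ι n h k) Ω) ∧
      (j = i → ∀ l, v l = algebraMap (ParamRing ι n h k) Ω (MvPolynomial.X (Sum.inl l))) := by
    by_cases hj : j = i
    · exact ⟨_, by rw [genericPoly_map, if_pos hj, add_zero], fun _ _ ↦ rfl⟩
    · obtain ⟨hm, hd⟩ := genericPoly_monic_natDegree (k := k) hn i j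
      obtain ⟨v, hv⟩ := exists_prod_X_sub_C_eq (hm.map (algebraMap (ParamRing ι n h k) Ω))
        ((hm.natDegree_map _).trans hd)
      exact ⟨v, hv, fun h ↦ (hj h).elim⟩
  choose v hv hvi using this
  exact ⟨fun x ↦ v x.1 x.2, hv, hvi i rfl⟩

theorem IsGenericPoint.coneIdeal_le_ker [Algebra k Ω] {i : ι} {w : ι × Fin n → Ω}
    (hw : IsGenericPoint k n h i w) (i₀ : ι) :
    coneIdeal k n h i₀ ≤ RingHom.ker (MvPolynomial.aeval (R := k) w) := by
  rw [coneIdeal_le_ker_iff]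
  intro j
  rw [hw.rowPoly_eq, hw.rowPoly_eq, ← Polynomial.map_sub]
  refine Polynomial.degree_map_le.trans_lt ?_
  rw [← sub_sub_sub_cancel_right _ _
    (∏ l, (Polynomial.X - Polynomial.C (MvPolynomial.X (Sum.inl l))))]
  exact (Polynomial.degree_sub_le _ _).trans_lt
    (max_lt (degree_genericPoly_sub_lt i j) (degree_genericPoly_sub_lt i i₀))

/-- Up to permutations inside the rows, the generic point specializes to every point of the
cone. -/
theorem IsGenericPoint.exists_aeval_rename_rowPerm_eq_zero [FaithfulSMul (ParamRing ι n h k) Ω]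
    [Algebra k Ω] [IsScalarTower k (ParamRing ι n h k) Ω] {i : ι} {w : ι × Fin n → Ω}
    (hw : IsGenericPoint k n h i w) (i₀ : ι) {F : Type*} [Field F] [IsAlgClosed F] [Algebra k F]
    {z : ι × Fin n → F}
    (hz : coneIdeal k n h i₀ ≤ RingHom.ker (MvPolynomial.aeval (R := k) z)) :
    ∃ g : ι → Equiv.Perm (Fin n), ∀ s : MvPolynomial (ι × Fin n) k, MvPolynomial.aeval w s = 0 →
      MvPolynomial.aeval z (MvPolynomial.rename (rowPerm g) s) = 0 := by
  rw [coneIdeal_le_ker_iff] at hz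
  let κ : ParamRing ι n h k →ₐ[k] F := MvPolynomial.aeval
    (Sum.elim (fun l ↦ z (i, l)) fun x ↦ (rowPoly z x.1 - rowPoly z i).coeff x.2)
  have hκ (j : ι) : (genericPoly k n h i j).map (κ : ParamRing ι n h k →+* F) = rowPoly z j := by
    rw [genericPoly_map]
    simp only [κ, RingHom.coe_coe, MvPolynomial.aeval_X, Sum.elim_inl, Sum.elim_inr]
    split_ifs with hj
    · rw [hj, add_zero, rowPoly]
    · rw [Polynomial.sum_fin_C_coeff_mul_X_pow (r := rowPoly z j - rowPoly z i), rowPoly, rowPoly,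
        add_sub_cancel]
      rw [← sub_sub_sub_cancel_right _ _ (rowPoly z i₀)]
      exact (Polynomial.degree_sub_le _ _).trans_lt (max_lt (hz j) (hz i))
  obtain ⟨g, hg⟩ := exists_perm_eval₂_eq_zero_of_specialization (κ : ParamRing ι n h k →+* F)
    (w := fun j l ↦ w (j, l)) (z := fun j l ↦ z (j, l)) hw.rowPoly_eq (fun j ↦ (hκ j).symm)
  refine ⟨g, fun s hs ↦ ?_⟩
  have h1 := hg (MvPolynomial.map (algebraMap k _) s)
    ((MvPolynomial.aeval_map_algebraMap _ _ _).trans hs)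
  rw [MvPolynomial.eval₂_map, AlgHom.comp_algebraMap] at h1
  rw [MvPolynomial.aeval_rename]
  exact h1

open Polynomial in
/-- The relations satisfied by the generic point with parameters in row `i` are stable under the
permutations of the row `i`. -/
theorem IsGenericPoint.aeval_rename_rowPerm_mulSingle_eq_zero [Finite ι] [IsAlgClosed k]
    [Algebra k Ω] [IsScalarTower k (ParamRing ι n h k) Ω] {K : Type*} [Field K]
    [Algebra (ParamRing ι n h k) K] [IsFractionRing (ParamRing ι n h k) K] [Algebra K Ω]
    [IsScalarTower (ParamRing ι n h k) K Ω] [IsAlgClosure K Ω] (hh : 1 ≤ h) {i : ι}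
    {w : ι × Fin n → Ω} (hw : IsGenericPoint k n h i w)
    (π : Equiv.Perm (Fin n)) {s : MvPolynomial (ι × Fin n) k} (hs : MvPolynomial.aeval w s = 0) :
    MvPolynomial.aeval w (MvPolynomial.rename (rowPerm (Pi.mulSingle i π)) s) = 0 := by
  obtain ⟨r, hr, hrs⟩ := Polynomial.exists_degree_lt_two_separable_X_pow_add (k := k) (n := n)
  replace hr : r.degree < (h + 1 : ℕ) := hr.trans_le (by exact_mod_cast Nat.succ_le_succ hh)
  let κ : ParamRing ι n h k →ₐ[k] k :=
    MvPolynomial.aeval (Sum.elim 0 fun x : ι × Fin (h + 1) ↦ r.coeff x.2)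
  let α : ParamRing ι n h k ≃ₐ[k] ParamRing ι n h k :=
    MvPolynomial.renameEquiv k (Equiv.sumCongr π (Equiv.refl _))
  have hαl (l : Fin n) : α (MvPolynomial.X (Sum.inl l)) = MvPolynomial.X (Sum.inl (π l)) := by
    simp [α]
  have hαr (x : ι × Fin (h + 1)) :
      α (MvPolynomial.X (Sum.inr x)) = MvPolynomial.X (Sum.inr x) := by
    simp [α]
  refine ShortIntervals.aeval_rename_rowPerm_mulSingle_eq_zero (K := K) hw.rowPoly_eq hw.apply_eq
    α hαl (fun j hj ↦ ?_) (κ : ParamRing ι n h k →+* k) (fun a ↦ ?_) (fun j hj ↦ ?_) hs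
  · rw [genericPoly_map, genericPoly, if_neg hj, if_neg hj]
    refine congrArg₂ (· + ·) (Fintype.prod_equiv π _ _ fun l ↦ ?_)
      (Finset.sum_congr rfl fun t _ ↦ ?_)
    · rw [RingHom.coe_coe, hαl]
    · rw [RingHom.coe_coe, hαr]
  · have : (κ.comp (α : ParamRing ι n h k →ₐ[k] ParamRing ι n h k)) = κ := by
      refine MvPolynomial.algHom_ext fun x ↦ ?_
      rcases x with l | x
      · simp [κ, α]
      · simp [κ, α]
    exact AlgHom.congr_fun this a
  · rw [genericPoly_map, if_neg hj]
    simpa [κ, Polynomial.sum_fin_C_coeff_mul_X_pow hr] using hrs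

end

theorem faithfulSMul_algebraicClosure_fractionRing (B : Type*) [CommRing B] [IsDomain B] :
    FaithfulSMul B (AlgebraicClosure (FractionRing B)) := by
  rw [faithfulSMul_iff_algebraMap_injective, IsScalarTower.algebraMap_eq B (FractionRing B)]
  exact (algebraMap (FractionRing B) (AlgebraicClosure (FractionRing B))).injective.comp
    (IsFractionRing.injective B (FractionRing B))

/-- A prime ideal is the ideal of relations of a point in an algebraically closed field. -/
theorem exists_ker_aeval_eq {k σ : Type*} [Field k] (Q : Ideal (MvPolynomial σ k)) [Q.IsPrime] :
    ∃ z : σ → AlgebraicClosure (FractionRing (MvPolynomial σ k ⧸ Q)),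
      RingHom.ker (MvPolynomial.aeval (R := k) z) = Q := by
  have := faithfulSMul_algebraicClosure_fractionRing (MvPolynomial σ k ⧸ Q)
  let ψ : MvPolynomial σ k →ₐ[k] AlgebraicClosure (FractionRing (MvPolynomial σ k ⧸ Q)) :=
    (IsScalarTower.toAlgHom k (MvPolynomial σ k ⧸ Q) _).comp (Ideal.Quotient.mkₐ k Q)
  refine ⟨ψ ∘ MvPolynomial.X, Ideal.ext fun s ↦ ?_⟩
  rw [RingHom.mem_ker, ← MvPolynomial.aeval_unique ψ, ← Ideal.Quotient.eq_zero_iff_mem]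
  exact map_eq_zero_iff _ (FaithfulSMul.algebraMap_injective (MvPolynomial σ k ⧸ Q)
    (AlgebraicClosure (FractionRing (MvPolynomial σ k ⧸ Q))))

theorem iSup_range_mulSingle {ι : Type*} [Finite ι] [DecidableEq ι] {G : ι → Type*}
    [∀ i, Group (G i)] : ⨆ i, (MonoidHom.mulSingle G i).range = ⊤ := by
  rw [eq_top_iff, ← Subgroup.pi_top Set.univ, Subgroup.pi_le_iff]
  exact fun i ↦ (MonoidHom.range_eq_map _).ge.trans
    (le_iSup (fun i ↦ (MonoidHom.mulSingle G i).range) i)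

open Pointwise in
/-- The cone over the space of rows with equal elementary symmetric polynomials of degrees
`1, …, n - h - 1` is irreducible. -/
theorem coneIdeal_radical_isPrime {k : Type*} [Field k] [IsAlgClosed k] [Finite ι]
    (hn : h < n) (hh : 1 ≤ h) (i₀ : ι) : (coneIdeal k n h i₀).radical.IsPrime := by
  classical
  let := rowPermAction ι n k
  have hsmul (g : ι → Equiv.Perm (Fin n)) (s : MvPolynomial (ι × Fin n) k) :
    g • s = MvPolynomial.rename (rowPerm g) s := rfl
  have hsub {g : ι → Equiv.Perm (Fin n)} {P Q : Ideal (MvPolynomial (ι × Fin n) k)}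
      (H : ∀ s ∈ P, MvPolynomial.rename (rowPerm g) s ∈ Q) : g • P ≤ Q := by
    rw [Ideal.pointwise_smul_subset_iff]
    exact fun s hs ↦ Ideal.mem_inv_pointwise_smul_iff.2 (H s hs)
  have hfix {N : Subgroup (ι → Equiv.Perm (Fin n))} {P : Ideal (MvPolynomial (ι × Fin n) k)}
      (H : ∀ g ∈ N, ∀ s ∈ P, MvPolynomial.rename (rowPerm g) s ∈ P) :
      ∀ g ∈ N, g • P = P := by
    refine fun g hg ↦ le_antisymm (hsub (H g hg)) ?_
    rw [Ideal.subset_pointwise_smul_iff]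
    exact hsub (H _ (inv_mem hg))
  have := faithfulSMul_algebraicClosure_fractionRing (ParamRing ι n h k)
  choose w hw using exists_isGenericPoint (k := k) (ι := ι)
    (Ω := AlgebraicClosure (FractionRing (ParamRing ι n h k))) hn
  have : Nonempty ι := ⟨i₀⟩
  have (i : ι) : (MonoidHom.mulSingle (fun _ : ι ↦ Equiv.Perm (Fin n)) i).range.Normal := by
    constructor
    rintro _ ⟨π, rfl⟩ g
    refine ⟨g i * π * (g i)⁻¹, ?_⟩
    ext1 j
    by_cases hj : j = i
    · subst hj; simp
    · simp [hj]
  refine Ideal.radical_isPrime_of_iSup_stabilizer_eq_top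
    (fun i ↦ (MonoidHom.mulSingle (fun _ : ι ↦ Equiv.Perm (Fin n)) i).range)
    iSup_range_mulSingle
    (fun g ↦ hfix (N := ⊤) (fun g _ s ↦ rename_rowPerm_mem_coneIdeal i₀ g) g (Subgroup.mem_top g))
    (fun i ↦ RingHom.ker (MvPolynomial.aeval (R := k) (w i))) (fun i ↦ RingHom.ker_isPrime _)
    (fun i ↦ (hw i).coneIdeal_le_ker i₀) (fun i Q hQ hIQ ↦ ?_) (fun i ↦ hfix ?_)
  · obtain ⟨z, hz⟩ := exists_ker_aeval_eq Q
    obtain ⟨g, hg⟩ := (hw i).exists_aeval_rename_rowPerm_eq_zero i₀ (hIQ.trans hz.ge)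
    exact ⟨g, hsub fun s hs ↦ hz.le (hg s hs)⟩
  · rintro _ ⟨π, rfl⟩ s hs
    exact (hw i).aeval_rename_rowPerm_mulSingle_eq_zero
      (K := FractionRing (ParamRing ι n h k)) hh π hs

end ShortIntervals



/-- For `k` algebraically closed (of characteristic `0` or `> n` when `m > 2`),
the radical of the ideal `I_{m,n,h}` of `k[z_{i,j}]` generated by
`e_n^j(z_{1,•}) - e_n^j(z_{i,•})`, `2 ≤ i ≤ m`, `1 ≤ j ≤ n - h - 1`, is a prime ideal;
equivalently, the zero locus of `I_{m,n,h}` in `Spec k[z_{i,j}]` (the affine cone `Y_{m,n,h}`)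
is irreducible. Row `1` is indexed by `⟨0, _⟩ : Fin m`. -/
theorem radical_isPrime_coneShortIntervals {k : Type*} [Field k] [IsAlgClosed k] (m n h : ℕ)
    (hm : 2 ≤ m) (hn : 4 ≤ n) (hh1 : 1 ≤ h) (hh2 : h ≤ n - 3)
    (hchar : 2 < m → ringChar k = 0 ∨ n < ringChar k) :
    (Ideal.span {p : MvPolynomial (Fin m × Fin n) k | ∃ (i : Fin m) (j : ℕ),
        i ≠ ⟨0, by omega⟩ ∧ 1 ≤ j ∧ j ≤ n - h - 1 ∧
        p = MvPolynomial.rename (Prod.mk (⟨0, by omega⟩ : Fin m)) (MvPolynomial.esymm (Fin n) k j) -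
            MvPolynomial.rename (Prod.mk i) (MvPolynomial.esymm (Fin n) k j)}).radical.IsPrime := by
  exact ShortIntervals.coneIdeal_radical_isPrime (by omega) hh1 _
end

section
/- Fix integers m ≥ 2, n ≥ 4, and 1 ≤ h ≤ n − 3, and fix permutations σ_1, …, σ_m of {1, …, n}. There exists a constant C > 0 such that for every finite field F with q elements (where, if m > 2, the characteristic of F is assumed greater than n), the following holds. Let K be an algebraic closure of F, and let N be the number of tuples (z_{i,j})_{1 ≤ i ≤ m, 1 ≤ j ≤ n} ∈ K^{mn} satisfying e_n^j(z_{1,1}, …, z_{1,n}) = e_n^j(z_{i,1}, …, z_{i,n}) for all 2 ≤ i ≤ m and 1 ≤ j ≤ n − h − 1, and z_{i,j}^q = z_{i, σ_i(j)} for all 1 ≤ i ≤ m and 1 ≤ j ≤ n. Then N is finite and |N − q^{n + (m−1)(h+1)}| ≤ C·q^{n + (m−2)(h+1)}. -/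
set_option linter.unusedSectionVars false

namespace ShortIntervalCone

open Polynomial

/-- Units of `F⟦X⟧` with constant coefficient one. -/
noncomputable def oneUnits (F : Type*) [Field F] : Subgroup (PowerSeries F)ˣ :=
  (Units.map (PowerSeries.constantCoeff (R := F)).toMonoidHom).ker

/-- The ideal of power series of order larger than `k`. -/
noncomputable def orderIdeal (F : Type*) [Field F] (k : ℕ) : Ideal (PowerSeries F) :=
  Ideal.span {PowerSeries.X ^ (k + 1)}

/-- The group `(1 + X F⟦X⟧) / (1 + X ^ (k + 1) F⟦X⟧)`. -/
abbrev JetGroup (F : Type*) [Field F] (k : ℕ) : Type _ :=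
  ((oneUnits F).map (Units.map (Ideal.Quotient.mk (orderIdeal F k)).toMonoidHom) :
    Subgroup (PowerSeries F ⧸ orderIdeal F k)ˣ)

section Jets

variable {F : Type*} [Field F] {k : ℕ}

/-- A power series with constant coefficient one, as a unit. -/
noncomputable def oneUnit (r : PowerSeries F) (hr : PowerSeries.constantCoeff r = 1) :
    (PowerSeries F)ˣ :=
  (PowerSeries.isUnit_iff_constantCoeff.2 (by rw [hr]; exact isUnit_one) : IsUnit r).unit

open Classical in
/-- The jet of a power series with constant coefficient one (and `1` for other series). -/
noncomputable def toJet (k : ℕ) (r : PowerSeries F) : JetGroup F k :=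
  if hr : PowerSeries.constantCoeff r = 1 then
    ⟨Units.map (Ideal.Quotient.mk (orderIdeal F k)).toMonoidHom (oneUnit r hr),
      Subgroup.mem_map_of_mem _ (by
        rw [oneUnits, MonoidHom.mem_ker]
        ext
        simpa [oneUnit] using hr)⟩
  else 1

lemma coe_toJet {r : PowerSeries F} (hr : PowerSeries.constantCoeff r = 1) :
    ((toJet k r : (PowerSeries F ⧸ orderIdeal F k)ˣ) : PowerSeries F ⧸ orderIdeal F k) =
      Ideal.Quotient.mk (orderIdeal F k) r := by
  rw [toJet, dif_pos hr]
  rfl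

lemma toJet_mul {r s : PowerSeries F} (hr : PowerSeries.constantCoeff r = 1)
    (hs : PowerSeries.constantCoeff s = 1) : toJet k (r * s) = toJet k r * toJet k s := by
  ext
  rw [coe_toJet (by simp [hr, hs])]
  simp [coe_toJet hr, coe_toJet hs]

lemma toJet_eq_iff {r s : PowerSeries F} (hr : PowerSeries.constantCoeff r = 1)
    (hs : PowerSeries.constantCoeff s = 1) :
    toJet k r = toJet k s ↔ ∀ j ≤ k, PowerSeries.coeff j r = PowerSeries.coeff j s := by
  rw [← Subtype.coe_inj, ← Units.val_inj, coe_toJet hr, coe_toJet hs, Ideal.Quotient.eq,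
    orderIdeal, Ideal.mem_span_singleton, PowerSeries.X_pow_dvd_iff]
  simp only [map_sub, sub_eq_zero, Nat.lt_succ_iff]

lemma exists_toJet_eq (g : JetGroup F k) :
    ∃ r : PowerSeries F, PowerSeries.constantCoeff r = 1 ∧ toJet k r = g := by
  obtain ⟨g, u, hu, rfl⟩ := g
  have h1 : PowerSeries.constantCoeff (u : PowerSeries F) = 1 := by
    have := (MonoidHom.mem_ker).1 hu
    simpa using congrArg Units.val this
  refine ⟨u, h1, ?_⟩
  ext
  rw [coe_toJet h1]
  rfl

/-- The jet at infinity of a monic polynomial: the class of `X ^ n * f (1 / X)`. -/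
noncomputable def jet (k : ℕ) (f : F[X]) : JetGroup F k := toJet k (f.reverse : PowerSeries F)

lemma constantCoeff_reverse {f : F[X]} (hf : f.Monic) :
    PowerSeries.constantCoeff (f.reverse : PowerSeries F) = 1 := by
  rw [← PowerSeries.coeff_zero_eq_constantCoeff_apply, Polynomial.coeff_coe,
    Polynomial.coeff_zero_reverse, hf.leadingCoeff]

lemma jet_mul {f g : F[X]} (hf : f.Monic) (hg : g.Monic) : jet k (f * g) = jet k f * jet k g := by
  rw [jet, reverse_mul_of_domain, Polynomial.coe_mul,
    toJet_mul (constantCoeff_reverse hf) (constantCoeff_reverse hg), jet, jet]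

lemma jet_one : jet k (1 : F[X]) = 1 := by
  have h := jet_mul (k := k) (monic_one (R := F)) monic_one
  simpa using h

lemma jet_eq_iff {f g : F[X]} (hf : f.Monic) (hg : g.Monic) :
    jet k f = jet k g ↔ ∀ j ≤ k, f.reverse.coeff j = g.reverse.coeff j := by
  rw [jet, jet, toJet_eq_iff (constantCoeff_reverse hf) (constantCoeff_reverse hg)]
  simp only [Polynomial.coeff_coe]

end Jets

section Monics

variable (F : Type*) [Field F] [Fintype F]

open Classical in
/-- The monic polynomials of degree `n` over a finite field. -/
noncomputable def monics (n : ℕ) : Finset F[X] :=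
  Finset.univ.image fun a : Fin n → F => X ^ n + ofFn n a

variable {F}

open Classical in
lemma mem_monics {n : ℕ} {f : F[X]} : f ∈ monics F n ↔ f.Monic ∧ f.natDegree = n := by
  simp only [monics, Finset.mem_image, Finset.mem_univ, true_and]
  constructor
  · rintro ⟨a, rfl⟩
    have h := ofFn_degree_lt a
    have h2 : (X ^ n + ofFn n a).Monic := monic_X_pow_add h
    refine ⟨h2, ?_⟩
    apply natDegree_eq_of_degree_eq_some
    rw [degree_add_eq_left_of_degree_lt (by simpa using h), degree_X_pow]
  · rintro ⟨hf, rfl⟩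
    refine ⟨fun i => f.coeff i, ?_⟩
    ext j
    rw [coeff_add, coeff_X_pow]
    rcases lt_trichotomy j f.natDegree with h | h | h
    · rw [ofFn_coeff_eq_val_of_lt _ h, if_neg h.ne, zero_add]
    · rw [ofFn_coeff_eq_zero_of_ge _ h.ge, if_pos h, add_zero, h]
      exact hf.leadingCoeff.symm
    · rw [ofFn_coeff_eq_zero_of_ge _ h.le, if_neg h.ne', coeff_eq_zero_of_natDegree_lt h, add_zero]

open Classical in
lemma card_monics (n : ℕ) : (monics F n).card = Fintype.card F ^ n := by
  rw [monics, Finset.card_image_of_injective, Finset.card_univ, Fintype.card_fun, Fintype.card_fin]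
  intro a b h
  exact injective_ofFn n (by simpa using h)

open Classical in
lemma card_filter_jet {n k : ℕ} (hk : k ≤ n) (g : JetGroup F k) :
    ((monics F n).filter fun f => jet k f = g).card = Fintype.card F ^ (n - k) := by
  obtain ⟨r, hr, rfl⟩ := exists_toJet_eq g
  set f₀ : F[X] := X ^ n + ofFn n fun i => PowerSeries.coeff (n - i) r with hf₀
  have hmem : f₀ ∈ monics F n := Finset.mem_image_of_mem _ (Finset.mem_univ _)
  obtain ⟨hm, hd⟩ := mem_monics.1 hmem
  have hr0 : PowerSeries.coeff 0 r = 1 := by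
    rw [PowerSeries.coeff_zero_eq_constantCoeff_apply, hr]
  have hc : ∀ i ≤ n, f₀.coeff i = PowerSeries.coeff (n - i) r := by
    intro i hi
    rw [hf₀, coeff_add, coeff_X_pow]
    rcases hi.lt_or_eq with h | h
    · rw [ofFn_coeff_eq_val_of_lt _ h, if_neg h.ne, zero_add]
    · rw [ofFn_coeff_eq_zero_of_ge _ h.ge, if_pos h, add_zero, h, Nat.sub_self, hr0]
  have hjet : ∀ f ∈ monics F n, jet k f = toJet k r ↔ (f - f₀).degree < (n - k : ℕ) := by
    intro f hf
    obtain ⟨hfm, hfd⟩ := mem_monics.1 hf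
    rw [jet, toJet_eq_iff (constantCoeff_reverse hfm) hr, degree_lt_iff_coeff_zero]
    simp only [Polynomial.coeff_coe, coeff_reverse, hfd, coeff_sub]
    constructor
    · intro h i hi
      rcases le_or_gt i n with h1 | h1
      · have := h (n - i) (by omega)
        rw [revAt_le (by omega), Nat.sub_sub_self h1] at this
        rw [this, hc i h1, sub_self]
      · rw [coeff_eq_zero_of_natDegree_lt (by omega), coeff_eq_zero_of_natDegree_lt (by omega),
          sub_self]
    · intro h j hj
      rw [revAt_le (by omega)]
      have := h (n - j) (by omega)
      rw [hc _ (by omega), sub_eq_zero, Nat.sub_sub_self (by omega)] at this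
      exact this
  have : (monics F n).filter (fun f => jet k f = toJet k r) =
      Finset.univ.image fun b : Fin (n - k) → F => f₀ + ofFn (n - k) b := by
    ext f
    simp only [Finset.mem_filter, Finset.mem_image, Finset.mem_univ, true_and]
    constructor
    · rintro ⟨hf, h⟩
      rw [hjet f hf] at h
      refine ⟨fun i => (f - f₀).coeff i, ?_⟩
      rw [← eq_sub_iff_add_eq']
      ext i
      rcases lt_or_ge i (n - k) with h1 | h1
      · rw [ofFn_coeff_eq_val_of_lt _ h1]
      · rw [ofFn_coeff_eq_zero_of_ge _ h1, ((degree_lt_iff_coeff_zero _ _).1 h) i h1]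
    · rintro ⟨b, rfl⟩
      have hb := ofFn_degree_lt b
      have hb' : (ofFn (n - k) b).degree < f₀.degree := by
        refine hb.trans_le ?_
        rw [degree_eq_natDegree hm.ne_zero, hd]
        exact_mod_cast Nat.sub_le n k
      have hmem' : f₀ + ofFn (n - k) b ∈ monics F n := by
        rw [mem_monics]
        refine ⟨hm.add_of_left hb', ?_⟩
        rw [natDegree_add_eq_left_of_degree_lt hb', hd]
      refine ⟨hmem', (hjet _ hmem').2 ?_⟩
      simpa using hb
  rw [this, Finset.card_image_of_injective, Finset.card_univ, Fintype.card_fun, Fintype.card_fin]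
  intro a b h
  exact injective_ofFn _ (by simpa using h)

instance (k : ℕ) : Finite (JetGroup F k) := by
  classical
  refine Finite.of_surjective (fun f : monics F k => jet k (f : F[X])) fun g => ?_
  have h := card_filter_jet le_rfl g
  rw [Nat.sub_self, pow_zero, Finset.card_eq_one] at h
  obtain ⟨f, hf⟩ := h
  have : f ∈ (monics F k).filter fun f => jet k f = g := by rw [hf]; simp
  rw [Finset.mem_filter] at this
  exact ⟨⟨f, this.1⟩, this.2⟩

noncomputable instance (k : ℕ) : Fintype (JetGroup F k) := Fintype.ofFinite _

lemma sum_monics_jet {M : Type*} [AddCommMonoid M] {n k : ℕ} (hk : k ≤ n) (φ : JetGroup F k → M) :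
    ∑ f ∈ monics F n, φ (jet k f) = Fintype.card F ^ (n - k) • ∑ g, φ g := by
  classical
  rw [← Finset.sum_fiberwise (monics F n) (jet k), Finset.smul_sum]
  refine Finset.sum_congr rfl fun g _ => ?_
  rw [← card_filter_jet hk g, Finset.sum_congr rfl (g := fun _ => φ g), Finset.sum_const]
  intro f hf
  rw [(Finset.mem_filter.1 hf).2]

lemma card_jetGroup (k : ℕ) : Fintype.card (JetGroup F k) = Fintype.card F ^ k := by
  have h := sum_monics_jet (F := F) (n := k) le_rfl (fun _ : JetGroup F k => 1)
  simpa [card_monics] using h.symm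

end Monics

section Frobenius

variable (F : Type*) {K : Type*} [Field F] [Fintype F] [Field K] [Algebra F K]

local notation "q" => Fintype.card F

lemma iterate_frobenius (i : ℕ) (a : K) : (fun x : K => x ^ q)^[i] a = a ^ q ^ i := by
  induction i with
  | zero => simp
  | succ i ih => rw [Function.iterate_succ_apply', ih, ← pow_mul, pow_succ]

/-- The `q ^ d`-power map as an algebra endomorphism. -/
noncomputable def frob (K : Type*) [Field K] [Algebra F K] (d : ℕ) : K →ₐ[F] K :=
  FiniteField.frobeniusAlgHom F K ^ d

@[simp] lemma frob_apply (d : ℕ) (a : K) : frob F K d a = a ^ q ^ d := by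
  rw [frob, AlgHom.coe_pow, FiniteField.coe_frobeniusAlgHom, iterate_frobenius]

lemma pow_card_pow_injective (d : ℕ) : Function.Injective fun a : K => a ^ q ^ d := by
  intro a b h
  apply (frob F K d).toRingHom.injective
  simpa using h

open Classical in
/-- The elements fixed by the `q ^ d`-power map. -/
noncomputable def fixed (K : Type*) [Field K] (d : ℕ) : Finset K :=
  (X ^ q ^ d - X : K[X]).roots.toFinset

open Classical in
lemma mem_fixed {d : ℕ} (hd : d ≠ 0) {a : K} : a ∈ fixed F K d ↔ a ^ q ^ d = a := by
  rw [fixed, Multiset.mem_toFinset, mem_roots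
    (FiniteField.X_pow_card_pow_sub_X_ne_zero K hd Fintype.one_lt_card)]
  simp [sub_eq_zero]

open Classical in
lemma card_fixed [IsAlgClosed K] {d : ℕ} (hd : d ≠ 0) : (fixed F K d).card = q ^ d := by
  obtain ⟨p, hp⟩ := CharP.exists F
  have : CharP K p := charP_of_injective_algebraMap (algebraMap F K).injective p
  have hpq : p ∣ q ^ d := by
    refine dvd_pow ?_ hd
    rw [← CharP.cast_eq_zero_iff F p]
    exact FiniteField.cast_card_eq_zero F
  have hsep := galois_poly_separable (K := K) p (q ^ d) hpq
  rw [fixed, Multiset.toFinset_card_of_nodup (nodup_roots hsep),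
    ← (IsAlgClosed.splits (X ^ q ^ d - X : K[X])).natDegree_eq_card_roots]
  exact FiniteField.X_pow_card_pow_sub_X_natDegree_eq K hd Fintype.one_lt_card

lemma exists_algebraMap_eq {a : K} (ha : a ^ q = a) : ∃ b : F, algebraMap F K b = a := by
  classical
  have h := FiniteField.roots_X_pow_card_sub_X F
  have hne : (X ^ q - X : K[X]) ≠ 0 :=
    FiniteField.X_pow_card_sub_X_ne_zero K Fintype.one_lt_card
  have hsub : Finset.univ.image (algebraMap F K) ⊆ (X ^ q - X : K[X]).roots.toFinset := by
    intro x hx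
    obtain ⟨b, -, rfl⟩ := Finset.mem_image.1 hx
    rw [Multiset.mem_toFinset, mem_roots hne]
    simp [← map_pow, FiniteField.pow_card]
  have hcard : (X ^ q - X : K[X]).roots.toFinset.card ≤
      (Finset.univ.image (algebraMap F K)).card := by
    rw [Finset.card_image_of_injective _ (algebraMap F K).injective, Finset.card_univ]
    calc _ ≤ _ := Multiset.toFinset_card_le _
      _ ≤ _ := card_roots' _
      _ = _ := FiniteField.X_pow_card_sub_X_natDegree_eq K Fintype.one_lt_card
  have hmem : a ∈ (X ^ q - X : K[X]).roots.toFinset := by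
    rw [Multiset.mem_toFinset, mem_roots hne]
    simp [ha]
  rw [← Finset.eq_of_subset_of_card_le hsub hcard] at hmem
  obtain ⟨b, -, hb⟩ := Finset.mem_image.1 hmem
  exact ⟨b, hb⟩

open Classical in
/-- A polynomial over `F` with the given image over `K`, if there is one. -/
noncomputable def descend (P : K[X]) : F[X] :=
  if h : ∃ f : F[X], f.map (algebraMap F K) = P then h.choose else 0

variable {F}

lemma map_descend {P : K[X]} (h : P.map (frob F K 1).toRingHom = P) :
    (descend F P).map (algebraMap F K) = P := by
  have : ∃ f : F[X], f.map (algebraMap F K) = P := by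
    rw [← mem_lifts, lifts_iff_coeff_lifts]
    intro n
    apply exists_algebraMap_eq F
    have := congrArg (fun p => coeff p n) h
    simpa using this
  rw [descend, dif_pos this]
  exact this.choose_spec

lemma descend_monic {P : K[X]} (h : P.map (frob F K 1).toRingHom = P) (hP : P.Monic) :
    (descend F P).Monic := by
  rw [← map_descend h] at hP
  exact monic_of_injective (algebraMap F K).injective hP

variable (F)

/-- The characteristic polynomial `∏_{i < d} (X - a ^ q ^ i)` of `a`. -/
noncomputable def normPoly (d : ℕ) (a : K) : K[X] :=
  ∏ i ∈ Finset.range d, (X - C (a ^ q ^ i))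

lemma normPoly_monic (d : ℕ) (a : K) : (normPoly F d a).Monic :=
  monic_prod_of_monic _ _ fun _ _ => monic_X_sub_C _

lemma natDegree_normPoly (d : ℕ) (a : K) : (normPoly F d a).natDegree = d := by
  rw [normPoly, natDegree_prod_of_monic _ _ fun _ _ => monic_X_sub_C _]
  simp only [natDegree_X_sub_C, Finset.sum_const, Finset.card_range, smul_eq_mul, mul_one]

lemma map_normPoly {d : ℕ} {a : K} (ha : a ^ q ^ d = a) :
    (normPoly F d a).map (frob F K 1).toRingHom = normPoly F d a := by
  have h1 : (normPoly F d a).map (frob F K 1).toRingHom =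
      ∏ i ∈ Finset.range d, (X - C (a ^ q ^ (i + 1))) := by
    rw [normPoly, Polynomial.map_prod]
    refine Finset.prod_congr rfl fun i _ => ?_
    simp [← pow_mul, pow_succ']
  have h2 := Finset.prod_range_succ (fun i => (X - C (a ^ q ^ i))) d
  rw [Finset.prod_range_succ'] at h2
  simp only [pow_zero, pow_one, ha] at h2
  rw [h1, normPoly]
  exact mul_right_cancel₀ (X_sub_C_ne_zero a) h2

/-- The norm polynomial of an element of degree dividing `d`, as a polynomial over `F`. -/
noncomputable def normPolyF (d : ℕ) (a : K) : F[X] := descend F (normPoly F d a)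

variable {F}

lemma map_normPolyF {d : ℕ} {a : K} (ha : a ^ q ^ d = a) :
    (normPolyF F d a).map (algebraMap F K) = normPoly F d a :=
  map_descend (map_normPoly F ha)

lemma normPolyF_mem_monics {d : ℕ} {a : K} (ha : a ^ q ^ d = a) :
    normPolyF F d a ∈ monics F d := by
  have h := descend_monic (map_normPoly F ha) (normPoly_monic F d a)
  refine mem_monics.2 ⟨h, ?_⟩
  rw [← natDegree_map (algebraMap F K), map_normPolyF ha, natDegree_normPoly]

lemma exists_period [Algebra.IsAlgebraic F K] (a : K) :
    a ∈ Function.periodicPts fun x : K => x ^ q := by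
  have : FiniteDimensional F (IntermediateField.adjoin F {a}) :=
    IntermediateField.adjoin.finiteDimensional (Algebra.IsIntegral.isIntegral a)
  have : Finite (IntermediateField.adjoin F {a}) := Module.finite_of_finite F
  have := Fintype.ofFinite (IntermediateField.adjoin F {a})
  have h := FiniteField.pow_card
    (⟨a, IntermediateField.mem_adjoin_simple_self F a⟩ : IntermediateField.adjoin F {a})
  rw [Module.card_eq_pow_finrank (K := F)] at h
  have h' := congrArg Subtype.val h
  refine ⟨_, Module.finrank_pos (R := F) (M := IntermediateField.adjoin F {a}), ?_⟩
  rw [Function.IsPeriodicPt, Function.IsFixedPt, iterate_frobenius]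
  simpa using h'

lemma rootMultiplicity_pow (f : F[X]) (a : K) (i : ℕ) :
    (f.map (algebraMap F K)).rootMultiplicity (a ^ q ^ i) =
      (f.map (algebraMap F K)).rootMultiplicity a := by
  have h := eq_rootMultiplicity_map (p := f.map (algebraMap F K))
    (frob F K i).toRingHom.injective a
  have h2 : (f.map (algebraMap F K)).map (frob F K i).toRingHom = f.map (algebraMap F K) := by
    rw [Polynomial.map_map]
    congr 1
    exact (frob F K i).comp_algebraMap
  rw [h2] at h
  simpa using h.symm

lemma normPoly_mul {d : ℕ} {a : K} (ha : a ^ q ^ d = a) (t : ℕ) :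
    normPoly F (d * t) a = normPoly F d a ^ t := by
  have hat : ∀ t : ℕ, a ^ q ^ (d * t) = a := by
    intro t
    induction t with
    | zero => simp
    | succ t ih => rw [Nat.mul_succ, pow_add, pow_mul, ih, ha]
  induction t with
  | zero => simp [normPoly]
  | succ t ih =>
    rw [Nat.mul_succ, normPoly, Finset.prod_range_add, ← normPoly, ih, pow_succ]
    congr 1
    refine Finset.prod_congr rfl fun i _ => ?_
    rw [pow_add, pow_mul, hat]

lemma normPoly_pow_dvd_iff {f : F[X]} (hf : f.Monic) (a : K)
    (ha : a ∈ Function.periodicPts fun x : K => x ^ q) (t : ℕ) :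
    normPoly F (Function.minimalPeriod (fun x : K => x ^ q) a) a ^ t ∣ f.map (algebraMap F K) ↔
      t ≤ (f.map (algebraMap F K)).rootMultiplicity a := by
  have hf0 : f.map (algebraMap F K) ≠ 0 := (hf.map _).ne_zero
  have hpos := Function.minimalPeriod_pos_of_mem_periodicPts ha
  set δ := Function.minimalPeriod (fun x : K => x ^ q) a with hδ
  rw [le_rootMultiplicity_iff hf0]
  constructor
  · intro h
    refine dvd_trans (pow_dvd_pow_of_dvd ?_ t) h
    have := Finset.dvd_prod_of_mem (fun i => (X - C (a ^ q ^ i))) (Finset.mem_range.2 hpos)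
    simpa [normPoly] using this
  · intro h
    rw [← le_rootMultiplicity_iff hf0] at h
    rw [normPoly, ← Finset.prod_pow]
    refine Finset.prod_dvd_of_coprime ?_ ?_
    · intro i hi j hj hij
      refine IsCoprime.pow (isCoprime_X_sub_C_of_isUnit_sub ?_)
      refine (sub_ne_zero_of_ne ?_).isUnit
      intro heq
      refine hij (Function.iterate_injOn_Iio_minimalPeriod (f := fun x : K => x ^ q) (x := a)
        (by simpa using hi) (by simpa using hj) ?_)
      simpa only [iterate_frobenius] using heq
    · intro i _
      rw [← le_rootMultiplicity_iff hf0, rootMultiplicity_pow]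
      exact h

open Classical in
lemma card_filter_normPoly_dvd [Algebra.IsAlgebraic F K] {n : ℕ} {f : F[X]}
    (hf : f ∈ monics F n) (a : K) :
    ((Finset.Icc 1 n).filter fun d =>
      a ^ q ^ d = a ∧ normPoly F d a ∣ f.map (algebraMap F K)).card =
      (f.map (algebraMap F K)).rootMultiplicity a := by
  obtain ⟨hfm, hfd⟩ := mem_monics.1 hf
  have ha := exists_period (F := F) a
  have hpos := Function.minimalPeriod_pos_of_mem_periodicPts ha
  set δ := Function.minimalPeriod (fun x : K => x ^ q) a with hδ
  have haδ : a ^ q ^ δ = a := by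
    rw [← iterate_frobenius]
    exact Function.isPeriodicPt_minimalPeriod _ _
  have : (Finset.Icc 1 n).filter (fun d =>
      a ^ q ^ d = a ∧ normPoly F d a ∣ f.map (algebraMap F K)) =
      (Finset.Icc 1 ((f.map (algebraMap F K)).rootMultiplicity a)).image fun t => δ * t := by
    ext d
    simp only [Finset.mem_filter, Finset.mem_Icc, Finset.mem_image]
    constructor
    · rintro ⟨⟨h1, -⟩, h2, h3⟩
      rw [← iterate_frobenius] at h2
      obtain ⟨t, rfl⟩ := Function.IsPeriodicPt.minimalPeriod_dvd h2
      rw [normPoly_mul haδ, normPoly_pow_dvd_iff hfm a ha] at h3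
      exact ⟨t, ⟨Nat.pos_of_ne_zero (by rintro rfl; simp at h1), h3⟩, rfl⟩
    · rintro ⟨t, ⟨h1, h2⟩, rfl⟩
      have h3 : normPoly F (δ * t) a ∣ f.map (algebraMap F K) := by
        rwa [normPoly_mul haδ, normPoly_pow_dvd_iff hfm a ha]
      refine ⟨⟨Nat.mul_pos hpos h1, ?_⟩, ?_, h3⟩
      · have := natDegree_le_of_dvd h3 (hfm.map _).ne_zero
        rwa [natDegree_normPoly, natDegree_map, hfd] at this
      · rw [← iterate_frobenius]
        exact (Function.isPeriodicPt_minimalPeriod _ _).mul_const t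
  rw [this, Finset.card_image_of_injective _ fun s t h => Nat.eq_of_mul_eq_mul_left hpos h,
    Nat.card_Icc,
    Nat.add_sub_cancel]

open Classical in
lemma sum_card_filter_normPoly_dvd [Algebra.IsAlgebraic F K] [IsAlgClosed K] {n : ℕ} {f : F[X]}
    (hf : f ∈ monics F n) :
    ∑ d ∈ Finset.Icc 1 n, ((fixed F K d).filter fun a =>
      normPoly F d a ∣ f.map (algebraMap F K)).card = n := by
  obtain ⟨hfm, hfd⟩ := mem_monics.1 hf
  set P := f.map (algebraMap F K) with hP
  have hP0 : P ≠ 0 := (hfm.map _).ne_zero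
  have h1 : ∀ d ∈ Finset.Icc 1 n, ((fixed F K d).filter fun a => normPoly F d a ∣ P).card =
      ∑ a ∈ P.roots.toFinset, if a ^ q ^ d = a ∧ normPoly F d a ∣ P then 1 else 0 := by
    intro d hd
    rw [← Finset.card_filter]
    congr 1
    ext a
    rw [Finset.mem_Icc] at hd
    simp only [Finset.mem_filter, mem_fixed F (show d ≠ 0 by omega), Multiset.mem_toFinset]
    constructor
    · rintro ⟨h2, h3⟩
      refine ⟨?_, h2, h3⟩
      rw [mem_roots hP0, ← dvd_iff_isRoot]
      refine dvd_trans ?_ h3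
      have := Finset.dvd_prod_of_mem (fun i => (X - C (a ^ q ^ i)))
        (Finset.mem_range.2 (show 0 < d by omega))
      simpa [normPoly] using this
    · rintro ⟨-, h2, h3⟩
      exact ⟨h2, h3⟩
  rw [Finset.sum_congr rfl h1, Finset.sum_comm]
  simp_rw [← Finset.card_filter]
  rw [Finset.sum_congr rfl fun a _ => card_filter_normPoly_dvd hf a]
  simp_rw [← hP, ← count_roots]
  rw [Multiset.toFinset_sum_count_eq, ← (IsAlgClosed.splits P).natDegree_eq_card_roots, hP,
    natDegree_map, hfd]

end Frobenius

section CharacterSums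

variable {F : Type*} (K : Type*) [Field F] [Fintype F] [Field K] [Algebra F K] {k : ℕ}

local notation "q" => Fintype.card F

/-- The sum of a character over the monic polynomials of degree `n`. -/
noncomputable def monicSum (φ : JetGroup F k →* ℂ) (n : ℕ) : ℂ := ∑ f ∈ monics F n, φ (jet k f)

/-- The sum of a character over the elements fixed by the `q ^ d`-power map. -/
noncomputable def pointSum (φ : JetGroup F k →* ℂ) (d : ℕ) : ℂ :=
  ∑ a ∈ fixed F K d, φ (jet k (normPolyF F d a))

lemma monicSum_zero (φ : JetGroup F k →* ℂ) : monicSum φ 0 = 1 := by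
  have h : monics F 0 = {1} := by
    ext f
    rw [mem_monics, Finset.mem_singleton]
    constructor
    · rintro ⟨h1, h2⟩
      exact h1.natDegree_eq_zero.1 h2
    · rintro rfl
      exact ⟨monic_one, natDegree_one⟩
  rw [monicSum, h, Finset.sum_singleton, jet_one, map_one]

lemma monicSum_eq_zero {φ : JetGroup F k →* ℂ} (hφ : ∑ g, φ g = 0) {n : ℕ} (hn : k ≤ n) :
    monicSum φ n = 0 := by
  rw [monicSum, sum_monics_jet hn, hφ, smul_zero]

lemma sum_filter_dvd (φ : JetGroup F k →* ℂ) {n d : ℕ} (hd : d ≤ n) {g : F[X]}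
    (hg : g ∈ monics F d) [DecidablePred fun f : F[X] => g ∣ f] :
    ∑ f ∈ (monics F n).filter fun f => g ∣ f, φ (jet k f) =
      φ (jet k g) * monicSum φ (n - d) := by
  obtain ⟨hgm, hgd⟩ := mem_monics.1 hg
  rw [monicSum, Finset.mul_sum]
  symm
  refine Finset.sum_bij (fun f _ => g * f) ?_ ?_ ?_ ?_
  · intro f hf
    obtain ⟨hfm, hfd⟩ := mem_monics.1 hf
    rw [Finset.mem_filter, mem_monics]
    refine ⟨⟨hgm.mul hfm, ?_⟩, dvd_mul_right _ _⟩
    rw [hgm.natDegree_mul hfm, hgd, hfd]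
    omega
  · intro f _ f' _ h
    exact mul_left_cancel₀ hgm.ne_zero h
  · intro f hf
    rw [Finset.mem_filter, mem_monics] at hf
    obtain ⟨⟨hfm, hfd⟩, f', rfl⟩ := hf
    have hf'm : f'.Monic := hgm.of_mul_monic_left hfm
    refine ⟨f', mem_monics.2 ⟨hf'm, ?_⟩, rfl⟩
    rw [hgm.natDegree_mul hf'm, hgd] at hfd
    omega
  · intro f hf
    rw [jet_mul hgm (mem_monics.1 hf).1, map_mul]

lemma nat_mul_monicSum [Algebra.IsAlgebraic F K] [IsAlgClosed K] (φ : JetGroup F k →* ℂ) (n : ℕ) :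
    n * monicSum φ n = ∑ d ∈ Finset.Icc 1 n, pointSum K φ d * monicSum φ (n - d) := by
  classical
  have h1 : ∀ d ∈ Finset.Icc 1 n, pointSum K φ d * monicSum φ (n - d) =
      ∑ f ∈ monics F n, φ (jet k f) * (((fixed F K d).filter fun a =>
        normPoly F d a ∣ f.map (algebraMap F K)).card : ℂ) := by
    intro d hd
    rw [Finset.mem_Icc] at hd
    rw [pointSum, Finset.sum_mul]
    have h2 : ∀ a ∈ fixed F K d, φ (jet k (normPolyF F d a)) * monicSum φ (n - d) =
        ∑ f ∈ monics F n, if normPoly F d a ∣ f.map (algebraMap F K) then φ (jet k f) else 0 := by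
      intro a ha
      rw [mem_fixed F (by omega)] at ha
      rw [← sum_filter_dvd φ hd.2 (normPolyF_mem_monics ha), Finset.sum_filter]
      refine Finset.sum_congr rfl fun f _ => ?_
      rw [← map_normPolyF ha, map_dvd_map']
    rw [Finset.sum_congr rfl h2, Finset.sum_comm]
    refine Finset.sum_congr rfl fun f _ => ?_
    rw [← Finset.sum_filter, Finset.sum_const, nsmul_eq_mul, mul_comm]
  rw [Finset.sum_congr rfl h1, Finset.sum_comm, monicSum, Finset.mul_sum]
  refine Finset.sum_congr rfl fun f hf => ?_
  rw [← Finset.mul_sum, ← Nat.cast_sum, sum_card_filter_normPoly_dvd hf, mul_comm]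

end CharacterSums

section PowerSums

lemma exists_eq_neg_sum_pow {k : ℕ} {A S : ℕ → ℂ} (hA0 : A 0 = 1) (hA : ∀ n, k < n → A n = 0)
    (hrec : ∀ n : ℕ, n * A n = ∑ d ∈ Finset.Icc 1 n, S d * A (n - d)) :
    ∃ γ : Fin k → ℂ, ∀ d, 1 ≤ d → S d = -∑ i, γ i ^ d := by
  classical
  set P : ℂ[X] := X ^ k + ofFn k fun i => A (k - i) with hP
  have hdeg := ofFn_degree_lt fun i : Fin k => A (k - i)
  have hPm : P.Monic := monic_X_pow_add hdeg
  have hPd : P.natDegree = k := by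
    apply natDegree_eq_of_degree_eq_some
    rw [hP, degree_add_eq_left_of_degree_lt (by simpa using hdeg), degree_X_pow]
  have hcoeff : ∀ i ≤ k, P.coeff i = A (k - i) := by
    intro i hi
    rw [hP, coeff_add, coeff_X_pow]
    rcases hi.lt_or_eq with h | h
    · rw [ofFn_coeff_eq_val_of_lt _ h, if_neg h.ne, zero_add]
    · rw [ofFn_coeff_eq_zero_of_ge _ h.ge, if_pos h, add_zero, h, Nat.sub_self, hA0]
  have hcard : P.roots.card = P.natDegree := (IsAlgClosed.splits P).natDegree_eq_card_roots.symm
  obtain ⟨γ, hγ⟩ : ∃ γ : Fin k → ℂ, Finset.univ.val.map γ = P.roots := by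
    have hl : P.roots.toList.length = k := by rw [Multiset.length_toList, hcard, hPd]
    refine ⟨fun i => P.roots.toList.get (i.cast hl.symm), ?_⟩
    rw [Fin.univ_val_map]
    conv_rhs => rw [← Multiset.coe_toList P.roots, ← List.ofFn_get P.roots.toList]
    rw [List.ofFn_congr hl]
  have hAe : ∀ n, A n = (-1) ^ n * (MvPolynomial.aeval γ (MvPolynomial.esymm (Fin k) ℂ n)) := by
    intro n
    rw [MvPolynomial.aeval_esymm_eq_multiset_esymm, hγ]
    rcases le_or_gt n k with h | h
    · have h2 := Polynomial.coeff_eq_esymm_roots_of_card hcard (k := k - n) (by omega)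
      rw [hcoeff _ (by omega), hPm.leadingCoeff, one_mul, hPd, Nat.sub_sub_self h] at h2
      exact h2
    · rw [hA n h, Multiset.esymm, Multiset.powersetCard_eq_empty _ (by omega)]
      simp
  set p : ℕ → ℂ := fun d => ∑ i, γ i ^ d with hp
  have hrec' : ∀ n : ℕ, n * A n = ∑ d ∈ Finset.Icc 1 n, (-p d) * A (n - d) := by
    intro n
    have h := congrArg (MvPolynomial.aeval γ) (MvPolynomial.mul_esymm_eq_sum (Fin k) ℂ n)
    simp only [map_mul, map_natCast, map_pow, map_neg, map_one, map_sum] at h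
    have h3 : ∀ d, MvPolynomial.aeval γ (MvPolynomial.psum (Fin k) ℂ d) = p d := by
      intro d
      simp [MvPolynomial.psum, hp]
    simp only [h3] at h
    have h4 : ∑ a ∈ (Finset.HasAntidiagonal.antidiagonal n).filter (fun a => a.1 < n),
        (-1) ^ a.1 * (MvPolynomial.aeval γ (MvPolynomial.esymm (Fin k) ℂ a.1)) * p a.2 =
        ∑ d ∈ Finset.Icc 1 n, p d * A (n - d) := by
      refine Finset.sum_bij' (fun a _ => a.2) (fun d _ => (n - d, d)) ?_ ?_ ?_ ?_ ?_
      · intro a ha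
        simp only [Finset.mem_filter, Finset.HasAntidiagonal.mem_antidiagonal, Finset.mem_Icc] at ha ⊢
        omega
      · intro d hd
        simp only [Finset.mem_filter, Finset.HasAntidiagonal.mem_antidiagonal, Finset.mem_Icc] at hd ⊢
        omega
      · intro a ha
        simp only [Finset.mem_filter, Finset.HasAntidiagonal.mem_antidiagonal] at ha
        ext <;> simp <;> omega
      · intro d hd
        rfl
      · intro a ha
        simp only [Finset.mem_filter, Finset.HasAntidiagonal.mem_antidiagonal] at ha
        rw [show n - a.2 = a.1 by omega, hAe a.1]
        ring
    rw [h4] at h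
    rw [hAe n, mul_left_comm, h, ← mul_assoc, ← pow_add, show n + (n + 1) = 2 * n + 1 by ring,
      pow_succ, pow_mul]
    simp [Finset.sum_neg_distrib]
  refine ⟨γ, fun d hd => ?_⟩
  induction d using Nat.strong_induction_on with
  | _ n ih =>
    obtain ⟨m, rfl⟩ := Nat.exists_eq_add_of_le' hd
    have h := (hrec (m + 1)).symm.trans (hrec' (m + 1))
    rw [Finset.sum_Icc_succ_top hd, Finset.sum_Icc_succ_top hd, Nat.sub_self, hA0, mul_one,
      mul_one] at h
    have h2 : ∀ d ∈ Finset.Icc 1 m, S d * A (m + 1 - d) = -p d * A (m + 1 - d) := by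
      intro d hd'
      rw [Finset.mem_Icc] at hd'
      rw [ih d (by omega) hd'.1]
    rw [Finset.sum_congr rfl h2] at h
    exact add_left_cancel h

lemma norm_le_one_of_bounded {ι : Type*} [Fintype ι] (β : ι → ℂ) (C : ℝ) (e₀ : ℕ)
    (h : ∀ e, e₀ ≤ e → ‖∑ i, β i ^ e‖ ≤ C) (i₀ : ι) : ‖β i₀‖ ≤ 1 := by
  classical
  set P : ℂ[X] := ∏ b ∈ (Finset.univ.image β).erase (β i₀), (X - Polynomial.C b) with hP
  have hP0 : P.eval (β i₀) ≠ 0 := by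
    rw [hP, eval_prod, Finset.prod_ne_zero_iff]
    intro b hb
    simpa [sub_eq_zero] using (Finset.ne_of_mem_erase hb).symm
  have hP1 : ∀ i, β i ≠ β i₀ → P.eval (β i) = 0 := by
    intro i hi
    rw [hP, eval_prod]
    exact Finset.prod_eq_zero (Finset.mem_erase.2 ⟨hi, Finset.mem_image_of_mem _ (by simp)⟩)
      (by simp)
  set c : ℂ := (Finset.univ.filter fun i => β i = β i₀).card * P.eval (β i₀) with hc
  have hc0 : 0 < ‖c‖ := by
    rw [norm_pos_iff, hc]
    refine mul_ne_zero ?_ hP0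
    rw [Nat.cast_ne_zero]
    exact Finset.card_ne_zero_of_mem (Finset.mem_filter.2 ⟨Finset.mem_univ i₀, rfl⟩)
  set D : ℝ := ∑ l ∈ Finset.range (P.natDegree + 1), ‖P.coeff l‖ * C with hD
  have key : ∀ e, e₀ ≤ e → ‖c‖ * ‖β i₀‖ ^ e ≤ D := by
    intro e he
    have h1 : c * β i₀ ^ e = ∑ l ∈ Finset.range (P.natDegree + 1),
        P.coeff l * ∑ i, β i ^ (e + l) := by
      have h2 : ∀ i, P.eval (β i) * β i ^ e = if β i = β i₀ then
          P.eval (β i₀) * β i₀ ^ e else 0 := by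
        intro i
        split_ifs with h
        · rw [h]
        · rw [hP1 i h, zero_mul]
      calc c * β i₀ ^ e = ∑ i, P.eval (β i) * β i ^ e := by
            rw [Finset.sum_congr rfl fun i _ => h2 i, ← Finset.sum_filter, Finset.sum_const,
              nsmul_eq_mul, hc, mul_assoc]
        _ = _ := by
            simp_rw [eval_eq_sum_range, Finset.sum_mul, Finset.mul_sum]
            rw [Finset.sum_comm]
            refine Finset.sum_congr rfl fun l _ => Finset.sum_congr rfl fun i _ => ?_
            ring
    rw [← norm_pow, ← norm_mul, h1]
    refine (norm_sum_le _ _).trans (Finset.sum_le_sum fun l _ => ?_)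
    rw [norm_mul]
    exact mul_le_mul_of_nonneg_left (h _ (by omega)) (norm_nonneg _)
  by_contra! hlt
  obtain ⟨n, hn⟩ := pow_unbounded_of_one_lt (D / ‖c‖) hlt
  have h1 := key (max n e₀) (le_max_right _ _)
  have h2 : ‖β i₀‖ ^ n ≤ ‖β i₀‖ ^ max n e₀ := pow_le_pow_right₀ hlt.le (le_max_left _ _)
  rw [div_lt_iff₀ hc0] at hn
  nlinarith

end PowerSums

section Degrees

/-- The degree `Q ^ (e - 1) + ... + Q ^ (e - j)`, for `j ≤ e`. -/
def powDeg (Q : ℕ) : ℕ → ℕ → ℕ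
  | _, 0 => 0
  | 0, _ + 1 => 0
  | e + 1, j + 1 => Q ^ e + powDeg Q e j

lemma powDeg_lt {Q : ℕ} (hQ : 2 ≤ Q) (e j : ℕ) : powDeg Q e j < Q ^ e := by
  induction e generalizing j with
  | zero => cases j <;> simp [powDeg]
  | succ e ih =>
    cases j with
    | zero => simp only [powDeg]; positivity
    | succ j =>
      have := ih j
      rw [powDeg, pow_succ]
      nlinarith [Nat.pow_pos (n := e) (show 0 < Q by omega)]

lemma powDeg_add (Q s : ℕ) {k j : ℕ} (hj : j ≤ k) :
    powDeg Q (k + s) j = Q ^ s * powDeg Q k j := by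
  induction k generalizing j with
  | zero =>
    obtain rfl : j = 0 := by omega
    cases s <;> simp [powDeg]
  | succ k ih =>
    cases j with
    | zero => simp [powDeg]
    | succ j =>
      rw [show k + 1 + s = k + s + 1 by ring, powDeg, powDeg, ih (by omega)]
      ring

lemma powDeg_self (Q k : ℕ) : ∃ u, powDeg Q (k + 1) (k + 1) = 1 + Q * u := by
  induction k with
  | zero => exact ⟨0, by simp [powDeg]⟩
  | succ k ih =>
    obtain ⟨u, hu⟩ := ih
    refine ⟨Q ^ k + u, ?_⟩
    rw [powDeg, hu]
    ring

lemma sum_powDeg_injective {Q : ℕ} (hQ : 0 < Q) {k : ℕ} {b b' : Fin k → Fin Q} {j j' : ℕ}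
    (h : ∑ r, (b r : ℕ) * powDeg Q k (r + 1) + Q ^ k * j =
      ∑ r, (b' r : ℕ) * powDeg Q k (r + 1) + Q ^ k * j') : b = b' ∧ j = j' := by
  induction k with
  | zero => exact ⟨Subsingleton.elim _ _, by simpa using h⟩
  | succ k ih =>
    obtain ⟨u, hu⟩ := powDeg_self Q k
    have h1 : ∀ (b : Fin (k + 1) → Fin Q) (j : ℕ),
        ∑ r, (b r : ℕ) * powDeg Q (k + 1) (r + 1) + Q ^ (k + 1) * j =
        b (Fin.last k) + Q * (b (Fin.last k) * u +
          (∑ r : Fin k, (b r.castSucc : ℕ) * powDeg Q k (r + 1) + Q ^ k * j)) := by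
      intro b j
      rw [Fin.sum_univ_castSucc]
      have h2 : ∀ r : Fin k, (b r.castSucc : ℕ) * powDeg Q (k + 1) ((r.castSucc : ℕ) + 1) =
          Q * ((b r.castSucc : ℕ) * powDeg Q k (r + 1)) := by
        intro r
        have := powDeg_add Q 1 (show (r : ℕ) + 1 ≤ k by omega)
        rw [Fin.val_castSucc, this]
        ring
      rw [Finset.sum_congr rfl fun r _ => h2 r, ← Finset.mul_sum, Fin.val_last, hu]
      ring
    rw [h1, h1] at h
    have hl : (b (Fin.last k) : ℕ) = b' (Fin.last k) := by
      have := congrArg (· % Q) h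
      simpa [Nat.mod_eq_of_lt] using this
    rw [hl] at h
    have h3 := Nat.eq_of_mul_eq_mul_left hQ (Nat.add_left_cancel h)
    obtain ⟨h4, h5⟩ := ih (b := fun r => b r.castSucc) (b' := fun r => b' r.castSucc)
      (Nat.add_left_cancel h3)
    refine ⟨funext fun r => ?_, h5⟩
    induction r using Fin.lastCases with
    | last => exact Fin.ext hl
    | cast r => exact congrFun h4 r

lemma sum_C_mul_ne_zero {F ι : Type*} [Field F] [Fintype ι] {f : ι → F[X]}
    (hf : ∀ t, f t ≠ 0) (hd : Function.Injective fun t => (f t).natDegree) {c : ι → F}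
    (hc : c ≠ 0) : ∑ t, C (c t) * f t ≠ 0 := by
  classical
  obtain ⟨t₁, ht₁⟩ := Function.ne_iff.1 hc
  obtain ⟨t₀, ht₀, hmax⟩ := Finset.exists_max_image (Finset.univ.filter fun t => c t ≠ 0)
    (fun t => (f t).natDegree) ⟨t₁, by simpa using ht₁⟩
  intro h
  have h1 := congrArg (fun p => coeff p (f t₀).natDegree) h
  simp only [finsetSum_coeff, coeff_C_mul, coeff_zero] at h1
  rw [Finset.sum_eq_single t₀] at h1
  · rw [coeff_natDegree, mul_eq_zero, leadingCoeff_eq_zero] at h1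
    rw [Finset.mem_filter] at ht₀
    exact h1.elim ht₀.2 (hf t₀)
  · intro t _ ht
    by_cases hct : c t = 0
    · rw [hct, zero_mul]
    · have h2 := hmax t (by simpa using hct)
      rw [coeff_eq_zero_of_natDegree_lt (lt_of_le_of_ne h2 (hd.ne ht)), mul_zero]
  · simp

lemma exists_relation {F ι : Type*} [Field F] [Fintype ι] {f : ι → F[X]} {D : ℕ}
    (hf : ∀ t, (f t).natDegree < D) (hD : D < Fintype.card ι) :
    ∃ c : ι → F, c ≠ 0 ∧ ∑ t, C (c t) * f t = 0 := by
  let L : (ι → F) →ₗ[F] (Fin D → F) :=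
    { toFun := fun c n => ∑ t, c t * (f t).coeff n
      map_add' := fun c c' => by
        ext n
        simp [add_mul, Finset.sum_add_distrib]
      map_smul' := fun a c => by
        ext n
        simp [mul_assoc, Finset.mul_sum] }
  have hker : LinearMap.ker L ≠ ⊥ := LinearMap.ker_ne_bot_of_finrank_lt (by simpa using hD)
  obtain ⟨c, hc, hc0⟩ := (Submodule.ne_bot_iff _).1 hker
  refine ⟨c, hc0, ?_⟩
  ext n
  simp only [finsetSum_coeff, coeff_C_mul, coeff_zero]
  rcases lt_or_ge n D with h | h
  · exact congrFun (LinearMap.mem_ker.1 hc) ⟨n, h⟩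
  · refine Finset.sum_eq_zero fun t _ => ?_
    rw [coeff_eq_zero_of_natDegree_lt ((hf t).trans_le h), mul_zero]

lemma eq_of_sum_antidiagonal_eq {R : Type*} [CommRing R] {y w z : ℕ → R} (hy : y 0 = 1) {k : ℕ}
    (h : ∀ j ≤ k, ∑ a ∈ Finset.HasAntidiagonal.antidiagonal j, y a.1 * w a.2 =
      ∑ a ∈ Finset.HasAntidiagonal.antidiagonal j, y a.1 * z a.2) : ∀ j ≤ k, w j = z j := by
  intro j hj
  induction j using Nat.strong_induction_on with
  | _ j ih =>
    have h1 := h j hj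
    have hmem : (0, j) ∈ Finset.HasAntidiagonal.antidiagonal j := by simp
    rw [← Finset.add_sum_erase _ _ hmem, ← Finset.add_sum_erase _ _ hmem, hy, one_mul, one_mul] at h1
    have h2 : ∀ a ∈ (Finset.HasAntidiagonal.antidiagonal j).erase (0, j),
        y a.1 * w a.2 = y a.1 * z a.2 := by
      intro a ha
      rw [Finset.mem_erase, Finset.HasAntidiagonal.mem_antidiagonal] at ha
      have : a.1 ≠ 0 := by
        intro h0
        exact ha.1 (Prod.ext h0 (by simp; omega))
      rw [ih a.2 (by omega) (by omega)]
    rw [Finset.sum_congr rfl h2] at h1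
    exact add_right_cancel h1

lemma exists_quotient_coeffs {F : Type*} [Field F] {y : ℕ → F[X]} (hy : y 0 = 1) {B : ℕ}
    (hB : ∀ j, (y j).natDegree ≤ j * B) (r : ℕ → F) :
    ∃ z : ℕ → F[X], (∀ j, ∑ a ∈ Finset.HasAntidiagonal.antidiagonal j, y a.1 * z a.2 = C (r j)) ∧
      ∀ j, (z j).natDegree ≤ j * B := by
  set Y : PowerSeries F[X] := PowerSeries.mk y with hY
  have hY1 : PowerSeries.constantCoeff Y = ((1 : F[X]ˣ) : F[X]) := by
    rw [← PowerSeries.coeff_zero_eq_constantCoeff_apply, hY, PowerSeries.coeff_mk, hy, Units.val_one]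
  set Z : PowerSeries F[X] := Y.invOfUnit 1 * PowerSeries.mk fun j => C (r j) with hZ
  have hYZ : Y * Z = PowerSeries.mk fun j => C (r j) := by
    rw [hZ, ← mul_assoc, PowerSeries.mul_invOfUnit _ _ hY1, one_mul]
  have hsum : ∀ j, ∑ a ∈ Finset.HasAntidiagonal.antidiagonal j,
      y a.1 * PowerSeries.coeff a.2 Z = C (r j) := by
    intro j
    have := congrArg (PowerSeries.coeff j) hYZ
    rw [PowerSeries.coeff_mul, PowerSeries.coeff_mk] at this
    simpa [hY] using this
  refine ⟨fun j => PowerSeries.coeff j Z, hsum, fun j => ?_⟩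
  induction j using Nat.strong_induction_on with
  | _ j ih =>
    have hmem : (0, j) ∈ Finset.HasAntidiagonal.antidiagonal j := by simp
    have h1 := hsum j
    rw [← Finset.add_sum_erase _ _ hmem, hy, one_mul, ← eq_sub_iff_add_eq] at h1
    change (PowerSeries.coeff (0, j).2 Z).natDegree ≤ j * B
    rw [h1]
    refine (natDegree_sub_le _ _).trans (max_le (by simp) ?_)
    refine natDegree_sum_le_of_forall_le _ _ fun a ha => ?_
    rw [Finset.mem_erase, Finset.HasAntidiagonal.mem_antidiagonal] at ha
    have h0 : a.1 ≠ 0 := by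
      intro h0
      exact ha.1 (Prod.ext h0 (by simp; omega))
    calc _ ≤ _ := natDegree_mul_le
      _ ≤ a.1 * B + a.2 * B := add_le_add (hB _) (ih _ (by omega))
      _ = _ := by rw [← add_mul, ha.2]

end Degrees

section Stepanov

variable (F : Type*) {K : Type*} [Field F] [Fintype F] [Field K] [Algebra F K]

local notation "q" => Fintype.card F

/-- The polynomial `∏_{i < e} (1 - X ^ q ^ i T)` in `T`. -/
noncomputable def genericNorm (e : ℕ) : F[X][X] :=
  ∏ i ∈ Finset.range e, (1 - C (X ^ q ^ i) * X)

lemma genericNorm_coeff_zero (e : ℕ) : (genericNorm F e).coeff 0 = 1 := by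
  rw [genericNorm, coeff_zero_eq_eval_zero, eval_prod]
  simp

lemma genericNorm_coeff_succ (e j : ℕ) : (genericNorm F (e + 1)).coeff (j + 1) =
    (genericNorm F e).coeff (j + 1) - X ^ q ^ e * (genericNorm F e).coeff j := by
  rw [genericNorm, Finset.prod_range_succ, ← genericNorm, mul_sub, mul_one, coeff_sub,
    mul_left_comm, coeff_C_mul, coeff_mul_X]

lemma genericNorm_coeff (e j : ℕ) : (e < j → (genericNorm F e).coeff j = 0) ∧
    (j ≤ e → (genericNorm F e).coeff j ≠ 0 ∧
      ((genericNorm F e).coeff j).natDegree = powDeg q e j) := by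
  induction e generalizing j with
  | zero => cases j <;> simp [genericNorm, powDeg, coeff_one]
  | succ e ih =>
    cases j with
    | zero => simp [genericNorm_coeff_zero, powDeg]
    | succ j =>
      rw [genericNorm_coeff_succ, powDeg]
      refine ⟨fun hj => ?_, fun hj => ?_⟩
      · rw [(ih j).1 (by omega), (ih (j + 1)).1 (by omega), mul_zero, sub_zero]
      · obtain ⟨h0, hd⟩ := (ih j).2 (by omega)
        have hlow : ((genericNorm F e).coeff (j + 1)).natDegree < q ^ e := by
          rcases le_or_gt (j + 1) e with h | h
          · rw [((ih (j + 1)).2 h).2]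
            exact powDeg_lt Fintype.one_lt_card _ _
          · rw [(ih (j + 1)).1 h, natDegree_zero]
            exact Nat.pow_pos Fintype.card_pos
        have hhigh : (X ^ q ^ e * (genericNorm F e).coeff j).natDegree = q ^ e + powDeg q e j := by
          rw [natDegree_X_pow_mul _ h0, hd, add_comm]
        have hdeg : ((genericNorm F e).coeff (j + 1) -
            X ^ q ^ e * (genericNorm F e).coeff j).natDegree = q ^ e + powDeg q e j := by
          rw [natDegree_sub_eq_right_of_natDegree_lt (by omega), hhigh]
        refine ⟨fun h => ?_, hdeg⟩
        rw [h, natDegree_zero] at hdeg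
        have : 0 < q ^ e := Nat.pow_pos Fintype.card_pos
        omega

lemma natDegree_genericNorm_coeff_le (e j : ℕ) :
    ((genericNorm F e).coeff j).natDegree ≤ j * q ^ e := by
  rcases Nat.eq_zero_or_pos j with rfl | hj
  · simp [genericNorm_coeff_zero]
  rcases le_or_gt j e with h | h
  · rw [((genericNorm_coeff F e j).2 h).2]
    exact (powDeg_lt Fintype.one_lt_card _ _).le.trans (Nat.le_mul_of_pos_left _ hj)
  · rw [(genericNorm_coeff F e j).1 h, natDegree_zero]
    exact Nat.zero_le _

lemma reverse_X_sub_C {R : Type*} [CommRing R] [Nontrivial R] (a : R) :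
    (X - C a).reverse = 1 - C a * X := by
  ext n
  rw [coeff_reverse, natDegree_X_sub_C]
  rcases n with _ | _ | n
  · simp [revAt_le]
  · simp [revAt_le, coeff_one]
  · rw [revAt_eq_self_of_lt (by omega)]
    simp [coeff_X, coeff_one]

lemma reverse_normPoly (e : ℕ) (a : K) :
    (normPoly F e a).reverse = (genericNorm F e).map (aeval (R := F) a).toRingHom := by
  induction e with
  | zero =>
    simp only [normPoly, genericNorm, Finset.range_zero, Finset.prod_empty, Polynomial.map_one]
    rw [← C_1, reverse_C]
  | succ e ih =>
    rw [normPoly, Finset.prod_range_succ, ← normPoly, reverse_mul_of_domain, ih, genericNorm,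
      genericNorm, Finset.prod_range_succ _ e, Polynomial.map_mul, reverse_X_sub_C]
    simp

lemma normPoly_add (d e : ℕ) (a : K) :
    normPoly F (d + e) a = normPoly F d a * normPoly F e (a ^ q ^ d) := by
  rw [normPoly, Finset.prod_range_add, normPoly, normPoly]
  simp only [pow_add, pow_mul]

variable {F}

lemma aeval_pow_card_pow (e : ℕ) (a : K) (p : F[X]) :
    aeval (a ^ q ^ e) p = (aeval a p) ^ q ^ e := by
  rw [← frob_apply F, ← frob_apply F, aeval_algHom_apply]

lemma sum_genericNorm_coeff {k e : ℕ} {a : K} (ha : a ^ q ^ (e + e) = a) {r : PowerSeries F}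
    (hr : PowerSeries.constantCoeff r = 1) (h : jet k (normPolyF F (e + e) a) = toJet k r)
    {j : ℕ} (hj : j ≤ k) :
    ∑ i ∈ Finset.HasAntidiagonal.antidiagonal j, aeval a ((genericNorm F e).coeff i.1) *
      (aeval a ((genericNorm F e).coeff i.2)) ^ q ^ e = algebraMap F K (PowerSeries.coeff j r) := by
  have hm := (mem_monics.1 (normPolyF_mem_monics ha)).1
  have h1 := (toJet_eq_iff (constantCoeff_reverse hm) hr).1 h j hj
  rw [Polynomial.coeff_coe] at h1
  have h2 : (normPoly F (e + e) a).reverse =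
      (normPolyF F (e + e) a).reverse.map (algebraMap F K) := by
    rw [← map_normPolyF ha]
    ext n
    rw [coeff_map, coeff_reverse, coeff_reverse, coeff_map, natDegree_map]
  have h3 := congrArg (fun p => coeff p j) h2
  simp only [coeff_map] at h3
  rw [h1, normPoly_add, reverse_mul_of_domain, reverse_normPoly, reverse_normPoly, coeff_mul] at h3
  rw [← h3]
  refine Finset.sum_congr rfl fun i _ => ?_
  rw [coeff_map, coeff_map]
  change _ = aeval a _ * aeval (a ^ q ^ e) _
  rw [aeval_pow_card_pow]

variable (K)

lemma exists_stepanov_poly {k s : ℕ} {y z : Fin k → F[X]} (hy0 : ∀ r, y r ≠ 0)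
    (hy : ∀ r, (y r).natDegree = q ^ s * powDeg q k (r + 1))
    (hz : ∀ r, (z r).natDegree ≤ k * q ^ (k + s)) (hs : q * k ^ 2 + 2 < q ^ (k + s)) :
    ∃ h : F[X], h ≠ 0 ∧
      h.natDegree ≤ q ^ (k + 2 * s) + (q * k ^ 2 + 2 + k * q) * q ^ (k + s) ∧
      ∀ a : K, (∀ r, aeval a (y r) ^ q ^ (k + s) = aeval a (z r)) →
        a ^ q ^ ((k + s) + (k + s)) = a → aeval a h = 0 := by
  set B := q ^ (k + s) with hB
  have hBs : B = q ^ s * q ^ k := by rw [hB, pow_add, mul_comm]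
  have hBs2 : q ^ (k + 2 * s) = B * q ^ s := by rw [hB]; ring
  set m := q ^ s + q * k ^ 2 + 1 with hm
  have hq : 0 < q := Fintype.card_pos
  have hsB : q ^ s ≤ B := by
    rw [hBs]
    exact Nat.le_mul_of_pos_right _ (Nat.pow_pos hq)
  let M : Fin (q ^ s) × Fin (m + 1) × (Fin k → Fin q) → F[X] := fun t =>
    X ^ (t.1 + B * t.2.1 : ℕ) * ∏ r, y r ^ (t.2.2 r : ℕ)
  let H : Fin (q ^ s) × Fin (m + 1) × (Fin k → Fin q) → F[X] := fun t =>
    X ^ (t.1 * B + t.2.1 : ℕ) * ∏ r, z r ^ (t.2.2 r : ℕ)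
  have hMne : ∀ t, M t ≠ 0 := fun t =>
    mul_ne_zero (pow_ne_zero _ X_ne_zero) (Finset.prod_ne_zero_iff.2 fun r _ => pow_ne_zero _ (hy0 r))
  have hMdeg : ∀ t, (M t).natDegree =
      t.1 + q ^ s * (∑ r, (t.2.2 r : ℕ) * powDeg q k (r + 1) + q ^ k * t.2.1) := by
    intro t
    rw [natDegree_X_pow_mul _ (Finset.prod_ne_zero_iff.2 fun r _ => pow_ne_zero _ (hy0 r)),
      natDegree_prod _ _ fun r _ => pow_ne_zero _ (hy0 r)]
    simp only [natDegree_pow, hy]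
    rw [mul_add, Finset.mul_sum, ← mul_assoc, ← hBs]
    simp only [mul_left_comm]
    ring
  have hinj : Function.Injective fun t => (M t).natDegree := by
    rintro ⟨i, j, b⟩ ⟨i', j', b'⟩ h
    simp only [hMdeg] at h
    have hi : (i : ℕ) = i' := by
      have := congrArg (· % q ^ s) h
      simpa [Nat.mod_eq_of_lt] using this
    rw [hi] at h
    obtain ⟨hb, hj⟩ := sum_powDeg_injective hq
      (Nat.eq_of_mul_eq_mul_left (Nat.pow_pos hq) (Nat.add_left_cancel h))
    exact Prod.ext (Fin.ext hi) (Prod.ext (Fin.ext hj) hb)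
  have hMle : ∀ t, (M t).natDegree ≤ q ^ s + B * m + k * q * B := by
    intro t
    rw [hMdeg, mul_add, ← mul_assoc, ← hBs, Finset.mul_sum]
    have h1 : ∑ r, q ^ s * ((t.2.2 r : ℕ) * powDeg q k (r + 1)) ≤ ∑ r : Fin k, q * B := by
      refine Finset.sum_le_sum fun r _ => ?_
      rw [hBs, mul_left_comm]
      exact Nat.mul_le_mul (t.2.2 r).2.le
        (Nat.mul_le_mul le_rfl (powDeg_lt Fintype.one_lt_card _ _).le)
    rw [Finset.sum_const, Finset.card_univ, Fintype.card_fin, smul_eq_mul, ← mul_assoc] at h1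
    have h2 : B * (t.2.1 : ℕ) ≤ B * m := Nat.mul_le_mul le_rfl (Nat.lt_succ_iff.1 t.2.1.2)
    have h3 := t.1.2.le
    omega
  have hHlt : ∀ t, (H t).natDegree < q ^ s * B + m + k * (q * (k * B)) + 1 := by
    intro t
    have h0 : (H t).natDegree ≤ (t.1 * B + t.2.1) + ∑ r, (t.2.2 r : ℕ) * (z r).natDegree := by
      refine natDegree_mul_le.trans (add_le_add (natDegree_X_pow _).le ?_)
      refine (natDegree_prod_le _ _).trans (Finset.sum_le_sum fun r _ => natDegree_pow_le)
    have h1 : ∑ r, (t.2.2 r : ℕ) * (z r).natDegree ≤ ∑ r : Fin k, q * (k * B) :=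
      Finset.sum_le_sum fun r _ => Nat.mul_le_mul (t.2.2 r).2.le (hz r)
    rw [Finset.sum_const, Finset.card_univ, Fintype.card_fin, smul_eq_mul] at h1
    have h2 : (t.1 : ℕ) * B ≤ q ^ s * B := Nat.mul_le_mul t.1.2.le le_rfl
    have h3 := Nat.lt_succ_iff.1 t.2.1.2
    omega
  obtain ⟨c, hc, hc0⟩ := exists_relation hHlt (by
    simp only [Fintype.card_prod, Fintype.card_fin, Fintype.card_fun]
    have : q ^ s * ((m + 1) * q ^ k) = B * (m + 1) := by rw [hBs]; ring
    rw [this, hm]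
    nlinarith)
  refine ⟨∑ t, C (c t) * M t, sum_C_mul_ne_zero hMne hinj hc, ?_, ?_⟩
  · have : (∑ t, C (c t) * M t).natDegree ≤ q ^ s + B * m + k * q * B :=
      natDegree_sum_le_of_forall_le _ _ fun t _ => (natDegree_C_mul_le _ _).trans (hMle t)
    refine this.trans ?_
    rw [hBs2, hm]
    nlinarith
  · intro a ha haB
    refine pow_card_pow_injective F (k + s) ?_
    change _ ^ q ^ (k + s) = 0 ^ q ^ (k + s)
    rw [zero_pow (pow_ne_zero _ hq.ne'), ← aeval_zero (R := F) a, ← hc0, ← frob_apply F,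
      map_sum, map_sum, map_sum]
    refine Finset.sum_congr rfl fun t _ => ?_
    rw [frob_apply, ← hB]
    simp only [M, H, map_mul, map_pow, map_prod, aeval_C, aeval_X, mul_pow, ← Finset.prod_pow]
    congr 1
    · rw [← map_pow, hB, FiniteField.pow_card_pow]
    congr 1
    · rw [pow_add, mul_pow, pow_add, ← pow_mul, ← pow_mul]
      congr 1
      rw [mul_right_comm, pow_mul]
      congr 1
      rw [hB, ← pow_add, haB]
    · refine Finset.prod_congr rfl fun r _ => ?_
      rw [← ha r, ← pow_mul, ← pow_mul, mul_comm]

variable [IsAlgClosed K]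

open Classical in
lemma card_filter_jet_normPolyF_le {k s : ℕ} (hs : q * k ^ 2 + 2 < q ^ (k + s))
    (g : JetGroup F k) :
    ((fixed F K ((k + s) + (k + s))).filter fun a =>
      jet k (normPolyF F ((k + s) + (k + s)) a) = g).card ≤
      q ^ (k + 2 * s) + (q * k ^ 2 + 2 + k * q) * q ^ (k + s) := by
  obtain ⟨r, hr, rfl⟩ := exists_toJet_eq g
  have he : (k + s) + (k + s) ≠ 0 := by
    intro h0
    have : k + s = 0 := by omega
    rw [this, pow_zero] at hs
    omega
  obtain ⟨z, hz, hzd⟩ := exists_quotient_coeffs (genericNorm_coeff_zero F (k + s))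
    (natDegree_genericNorm_coeff_le F (k + s)) fun j => PowerSeries.coeff j r
  obtain ⟨h, hh0, hhd, hh⟩ := exists_stepanov_poly K (k := k) (s := s)
    (y := fun r => (genericNorm F (k + s)).coeff (r + 1)) (z := fun r => z (r + 1))
    (fun r => ((genericNorm_coeff F _ _).2 (by omega)).1)
    (fun r => by
      rw [((genericNorm_coeff F _ _).2 (by omega)).2]
      exact powDeg_add _ _ (by omega))
    (fun r => (hzd _).trans (Nat.mul_le_mul (by omega) le_rfl)) hs
  refine le_trans ?_ hhd
  have hmap : h.map (algebraMap F K) ≠ 0 := Polynomial.map_ne_zero hh0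
  calc _ ≤ (h.map (algebraMap F K)).roots.toFinset.card := by
        refine Finset.card_le_card fun a ha => ?_
        rw [Finset.mem_filter, mem_fixed F he] at ha
        rw [Multiset.mem_toFinset, mem_roots hmap, IsRoot, eval_map_algebraMap]
        refine hh a (fun j => ?_) ha.1
        refine eq_of_sum_antidiagonal_eq
          (y := fun j => aeval a ((genericNorm F (k + s)).coeff j))
          (w := fun j => aeval a ((genericNorm F (k + s)).coeff j) ^ q ^ (k + s))
          (z := fun j => aeval a (z j)) (k := k) ?_ ?_ (j + 1) (by omega)
        · simp [genericNorm_coeff_zero]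
        · intro j hj
          rw [sum_genericNorm_coeff ha.1 hr ha.2 hj]
          have := congrArg (aeval a) (hz j)
          simpa using this.symm
    _ ≤ _ := Multiset.toFinset_card_le _
    _ ≤ _ := card_roots' _
    _ = _ := natDegree_map _

end Stepanov

section CharacterSums

lemma norm_monoidHom {G : Type*} [Group G] [Finite G] (φ : G →* ℂ) (g : G) : ‖φ g‖ = 1 := by
  refine Complex.norm_eq_one_of_pow_eq_one (n := Nat.card G) ?_ Nat.card_pos.ne'
  rw [← map_pow, pow_card_eq_one', map_one]

lemma norm_sum_mul_le {G : Type*} [Fintype G] {μ : G → ℝ} {M : ℝ} (hμ : ∀ g, μ g ≤ M) {φ : G → ℂ}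
    (hφ : ∀ g, ‖φ g‖ = 1) (h0 : ∑ g, φ g = 0) :
    ‖∑ g, (μ g : ℂ) * φ g‖ ≤ Fintype.card G * M - ∑ g, μ g := by
  have h1 : ∑ g, (μ g : ℂ) * φ g = -∑ g, ((M - μ g : ℝ) : ℂ) * φ g := by
    push_cast
    simp only [sub_mul, Finset.sum_sub_distrib, ← Finset.mul_sum, h0]
    ring
  rw [h1, norm_neg]
  calc _ ≤ ∑ g, ‖((M - μ g : ℝ) : ℂ) * φ g‖ := norm_sum_le _ _
    _ = ∑ g, (M - μ g) := by
        refine Finset.sum_congr rfl fun g _ => ?_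
        rw [norm_mul, hφ, mul_one, Complex.norm_of_nonneg (sub_nonneg.2 (hμ g))]
    _ = _ := by simp

variable {F : Type*} (K : Type*) [Field F] [Fintype F] [Field K] [Algebra F K] {k : ℕ}

local notation "q" => Fintype.card F

variable [IsAlgClosed K]

lemma norm_pointSum_even_le {φ : JetGroup F k →* ℂ} (hφ : ∑ g, φ g = 0) {s : ℕ}
    (hs : q * k ^ 2 + 2 < q ^ (k + s)) : ‖pointSum K φ ((k + s) + (k + s))‖ ≤
      (q * k ^ 2 + 2 + k * q : ℝ) * q ^ k * q ^ (k + s) := by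
  classical
  have he : (k + s) + (k + s) ≠ 0 := by
    intro h0
    have : k + s = 0 := by omega
    rw [this, pow_zero] at hs
    omega
  have h1 : pointSum K φ ((k + s) + (k + s)) =
      ∑ g, (((((fixed F K ((k + s) + (k + s))).filter fun a =>
        jet k (normPolyF F ((k + s) + (k + s)) a) = g).card : ℝ)) : ℂ) * φ g := by
    rw [pointSum, ← Finset.sum_fiberwise (fixed F K _)
      (fun a => jet k (normPolyF F ((k + s) + (k + s)) a))]
    refine Finset.sum_congr rfl fun g _ => ?_
    rw [Finset.sum_congr rfl (g := fun _ => φ g) (fun a ha => by rw [(Finset.mem_filter.1 ha).2])]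
    simp
  rw [h1]
  refine (norm_sum_mul_le (M := q ^ (k + 2 * s) + (q * k ^ 2 + 2 + k * q) * q ^ (k + s))
    (fun g => ?_) (norm_monoidHom φ) hφ).trans ?_
  · exact_mod_cast card_filter_jet_normPolyF_le K hs g
  · have h2 := Finset.card_eq_sum_card_fiberwise (s := fixed F K ((k + s) + (k + s)))
      (f := fun a => jet k (normPolyF F ((k + s) + (k + s)) a)) (t := Finset.univ) (by simp)
    rw [card_fixed F he] at h2
    rw [card_jetGroup, ← Nat.cast_sum, ← h2]
    push_cast
    apply le_of_eq
    ring

lemma norm_pointSum_le [Algebra.IsAlgebraic F K] {φ : JetGroup F k →* ℂ} (hφ : ∑ g, φ g = 0) {d : ℕ}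
    (hd : 1 ≤ d) : ‖pointSum K φ d‖ ≤ k * √q ^ d := by
  obtain ⟨γ, hγ⟩ := exists_eq_neg_sum_pow (k := k) (monicSum_zero φ)
    (fun n hn => monicSum_eq_zero hφ hn.le) (nat_mul_monicSum K φ)
  have hq : (0 : ℝ) < q := by exact_mod_cast Fintype.card_pos
  have hγ1 : ∀ i, ‖γ i‖ ≤ √q := by
    intro i
    have h1 := norm_le_one_of_bounded (fun i => γ i ^ 2 / q)
      ((q * k ^ 2 + 2 + k * q : ℝ) * q ^ k) (k + (q * k ^ 2 + 2)) (fun e he => ?_) i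
    · rw [norm_div, norm_pow, Complex.norm_natCast, div_le_one hq] at h1
      exact Real.le_sqrt_of_sq_le h1
    · obtain ⟨s, rfl⟩ : ∃ s, e = k + s := ⟨e - k, by omega⟩
      have h2 : q * k ^ 2 + 2 < q ^ (k + s) :=
        (show q * k ^ 2 + 2 ≤ k + s by omega).trans_lt (Nat.lt_pow_self Fintype.one_lt_card)
      have h3 := norm_pointSum_even_le K hφ h2
      rw [hγ _ (by omega), norm_neg] at h3
      have h4 : ∑ i, (γ i ^ 2 / q) ^ (k + s) =
          (∑ i, γ i ^ ((k + s) + (k + s))) / q ^ (k + s) := by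
        rw [Finset.sum_div]
        refine Finset.sum_congr rfl fun i _ => ?_
        rw [div_pow, ← pow_mul, two_mul]
      rw [h4, norm_div, norm_pow, Complex.norm_natCast, div_le_iff₀ (by positivity)]
      exact h3
  rw [hγ d hd, norm_neg]
  calc _ ≤ ∑ i, ‖γ i ^ d‖ := norm_sum_le _ _
    _ ≤ ∑ i : Fin k, √q ^ d := Finset.sum_le_sum fun i _ => by
        rw [norm_pow]
        exact pow_le_pow_left₀ (norm_nonneg _) (hγ1 i) d
    _ = _ := by simp

end CharacterSums

section Orbits

variable {ι : Type*} [Finite ι] (σ : Equiv.Perm ι) (a : ι)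

lemma minimalPeriod_perm_pos : 0 < Function.minimalPeriod σ a :=
  Function.minimalPeriod_pos_of_mem_periodicPts (σ.injective.mem_periodicPts a)

lemma exists_iterate_of_sameCycle {b : ι} (h : σ.SameCycle a b) :
    ∃ i < Function.minimalPeriod σ a, σ^[i] a = b := by
  obtain ⟨i, -, hi⟩ := h.exists_pow_eq'
  refine ⟨i % Function.minimalPeriod σ a, Nat.mod_lt _ (minimalPeriod_perm_pos σ a), ?_⟩
  rw [Function.iterate_mod_minimalPeriod_eq, ← hi, Equiv.Perm.coe_pow]

lemma sameCycle_iterate (i : ℕ) : σ.SameCycle a (σ^[i] a) :=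
  ⟨i, by rw [zpow_natCast, Equiv.Perm.coe_pow]⟩

@[to_additive]
lemma prod_sameCycle {M : Type*} [CommMonoid M] [Fintype {j // σ.SameCycle a j}] (f : ι → M) :
    ∏ j : {j // σ.SameCycle a j}, f j =
      ∏ i ∈ Finset.range (Function.minimalPeriod σ a), f (σ^[i] a) := by
  symm
  refine Finset.prod_bij (fun i _ => ⟨σ^[i] a, sameCycle_iterate σ a i⟩) (by simp) ?_ ?_ (by simp)
  · intro i hi j hj h
    exact Function.iterate_injOn_Iio_minimalPeriod (by simpa using hi) (by simpa using hj)
      (congrArg Subtype.val h)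
  · rintro ⟨b, hb⟩ -
    obtain ⟨i, hi, h⟩ := exists_iterate_of_sameCycle σ a hb
    exact ⟨i, by simpa using hi, Subtype.ext h⟩

end Orbits

section Twisted

variable {F : Type*} (K : Type*) [Field F] [Fintype F] [Field K] [Algebra F K]

local notation "q" => Fintype.card F

variable (F) in
open Classical in
/-- The tuples on which the `q`-power map acts by the permutation `σ`. -/
noncomputable def twisted {ι : Type*} [Fintype ι] (σ : Equiv.Perm ι) : Finset (ι → K) :=
  (Fintype.piFinset fun _ => fixed F K (orderOf σ)).filter fun z => ∀ j, z j ^ q = z (σ j)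

variable {K} {ι : Type*} [Fintype ι] {σ : Equiv.Perm ι}

lemma twisted_iterate {z : ι → K} (hz : ∀ j, z j ^ q = z (σ j)) (i : ℕ) (j : ι) :
    z j ^ q ^ i = z (σ^[i] j) := by
  induction i with
  | zero => simp
  | succ i ih => rw [pow_succ, pow_mul, ih, hz, Function.iterate_succ_apply']

lemma mem_twisted {z : ι → K} : z ∈ twisted F K σ ↔ ∀ j, z j ^ q = z (σ j) := by
  classical
  rw [twisted, Finset.mem_filter, Fintype.mem_piFinset, and_iff_right_iff_imp]
  intro hz j
  rw [mem_fixed F (orderOf_pos σ).ne', twisted_iterate hz, ← Equiv.Perm.coe_pow, pow_orderOf_eq_one,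
    Equiv.Perm.one_apply]

variable (F) in
/-- The polynomial over `F` with the given roots. -/
noncomputable def rootPoly (z : ι → K) : F[X] := descend F (∏ j, (X - C (z j)))

lemma map_rootPoly {z : ι → K} (hz : z ∈ twisted F K σ) :
    (rootPoly F z).map (algebraMap F K) = ∏ j, (X - C (z j)) := by
  apply map_descend
  rw [mem_twisted] at hz
  rw [Polynomial.map_prod, ← Equiv.prod_comp σ (fun j => X - C (z j))]
  refine Finset.prod_congr rfl fun j _ => ?_
  simp [← hz]

lemma rootPoly_mem_monics {z : ι → K} (hz : z ∈ twisted F K σ) :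
    rootPoly F z ∈ monics F (Fintype.card ι) := by
  have h := map_rootPoly hz
  refine mem_monics.2 ⟨monic_of_injective (algebraMap F K).injective ?_, ?_⟩
  · rw [h]
    exact monic_prod_of_monic _ _ fun _ _ => monic_X_sub_C _
  · rw [← natDegree_map (algebraMap F K), h, natDegree_prod_of_monic _ _ fun _ _ => monic_X_sub_C _]
    simp

variable (K) in
/-- The sum of a character over the tuples on which the `q`-power map acts by `σ`. -/
noncomputable def twistedSum {k : ℕ} (φ : JetGroup F k →* ℂ) (σ : Equiv.Perm ι) : ℂ :=
  ∑ z ∈ twisted F K σ, φ (jet k (rootPoly F z))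

variable (σ) in
/-- The restriction of `σ` to the complement of the orbit of `a`. -/
noncomputable def permCompl (a : ι) : Equiv.Perm {j // ¬ σ.SameCycle a j} :=
  σ.subtypePerm fun _ => not_congr Equiv.Perm.sameCycle_apply_right

open Classical in
variable (σ) in
lemma twistedSum_eq_mul {k : ℕ} (φ : JetGroup F k →* ℂ) (a : ι) :
    twistedSum K φ σ =
      pointSum K φ (Function.minimalPeriod σ a) * twistedSum K φ (permCompl σ a) := by
  set d := Function.minimalPeriod σ a with hd
  have hd0 : d ≠ 0 := (minimalPeriod_perm_pos σ a).ne'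
  rw [pointSum, twistedSum, twistedSum, Finset.sum_mul_sum, ← Finset.sum_product']
  refine Finset.sum_bij (fun z _ => (z a, fun j => z j)) ?_ ?_ ?_ ?_
  · intro z hz
    rw [mem_twisted] at hz
    rw [Finset.mem_product, mem_fixed F hd0, mem_twisted, twisted_iterate hz,
      Function.iterate_minimalPeriod]
    exact ⟨rfl, fun j => hz j⟩
  · intro z hz w hw h
    rw [mem_twisted] at hz hw
    obtain ⟨h1, h2⟩ := Prod.ext_iff.1 h
    funext j
    by_cases hj : σ.SameCycle a j
    · obtain ⟨i, -, rfl⟩ := exists_iterate_of_sameCycle σ a hj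
      rw [← twisted_iterate hz, ← twisted_iterate hw]
      exact congrArg (· ^ q ^ i) h1
    · exact congrFun h2 ⟨j, hj⟩
  · rintro ⟨α, w⟩ h
    rw [Finset.mem_product, mem_fixed F hd0, mem_twisted] at h
    obtain ⟨hα, hw⟩ := h
    have hmod : ∀ i : ℕ, α ^ q ^ (i % d) = α ^ q ^ i := by
      intro i
      rw [← iterate_frobenius F, ← iterate_frobenius F]
      refine Function.IsPeriodicPt.iterate_mod_apply ?_ i
      rw [Function.IsPeriodicPt, Function.IsFixedPt, iterate_frobenius, hα]
    have hex : ∀ j : {j // σ.SameCycle a j}, ∃ i < d, σ^[i] a = j :=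
      fun j => exists_iterate_of_sameCycle σ a j.2
    choose i hi hij using hex
    have hpow : ∀ (m : ℕ) (j) , σ^[m] a = j.1 → α ^ q ^ i j = α ^ q ^ m := by
      intro m j hm
      rw [← hmod m]
      congr 2
      refine Function.iterate_injOn_Iio_minimalPeriod (f := σ) (x := a) (hi j)
        (Nat.mod_lt _ (Nat.pos_of_ne_zero hd0)) ?_
      change σ^[i j] a = σ^[m % d] a
      rw [hij, Function.iterate_mod_minimalPeriod_eq, hm]
    let z : ι → K := fun j => if hj : σ.SameCycle a j then α ^ q ^ i ⟨j, hj⟩ else w ⟨j, hj⟩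
    have hz : ∀ j, z j ^ q = z (σ j) := by
      intro j
      by_cases hj : σ.SameCycle a j
      · have hj' : σ.SameCycle a (σ j) := Equiv.Perm.sameCycle_apply_right.2 hj
        simp only [z]
        rw [dif_pos hj, dif_pos hj', hpow (i ⟨j, hj⟩ + 1) ⟨σ j, hj'⟩, ← pow_mul, pow_succ]
        rw [Function.iterate_succ_apply', hij]
      · have hj' : ¬ σ.SameCycle a (σ j) := mt Equiv.Perm.sameCycle_apply_right.1 hj
        simp only [z]
        rw [dif_neg hj, dif_neg hj']
        exact hw ⟨j, hj⟩
    refine ⟨z, mem_twisted.2 hz, Prod.ext ?_ (funext fun j => ?_)⟩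
    · have ha : σ.SameCycle a a := Equiv.Perm.SameCycle.refl _ _
      simp only [z]
      rw [dif_pos ha, hpow 0 ⟨a, ha⟩ rfl, pow_zero, pow_one]
    · simp only [z]
      rw [dif_neg j.2]
  · intro z hz
    have hz' := mem_twisted.1 hz
    have hα : z a ^ q ^ d = z a := by rw [twisted_iterate hz', Function.iterate_minimalPeriod]
    have hw : (fun j => z j : {j // ¬ σ.SameCycle a j} → K) ∈ twisted F K (permCompl σ a) :=
      mem_twisted.2 fun j => hz' j
    rw [← map_mul, ← jet_mul (mem_monics.1 (normPolyF_mem_monics hα)).1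
      (mem_monics.1 (rootPoly_mem_monics hw)).1]
    congr 2
    apply map_injective _ (algebraMap F K).injective
    rw [Polynomial.map_mul, map_rootPoly hz, map_rootPoly hw, map_normPolyF hα, normPoly,
      ← Fintype.prod_subtype_mul_prod_subtype (σ.SameCycle a), prod_sameCycle σ a fun j => X - C (z j)]
    simp only [twisted_iterate hz', ← hd]

end Twisted

section TwistedSum

variable (F K : Type*) [Field F] [Fintype F] [Field K] [Algebra F K]

local notation "q" => Fintype.card F

lemma exists_twistedSum_eq_prod (n : ℕ) {ι : Type*} [Fintype ι] (σ : Equiv.Perm ι)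
    (hn : Fintype.card ι = n) : ∃ l : List ℕ, (∀ d ∈ l, 1 ≤ d) ∧ l.sum = n ∧
      ∀ (k : ℕ) (φ : JetGroup F k →* ℂ), twistedSum K φ σ = (l.map (pointSum K φ)).prod := by
  classical
  induction n using Nat.strong_induction_on generalizing ι with
  | _ n ih =>
    rcases isEmpty_or_nonempty ι with h | ⟨⟨a⟩⟩
    · refine ⟨[], by simp, by simp [← hn], fun k φ => ?_⟩
      have h1 : twisted F K σ = {isEmptyElim} := by
        ext z
        simp [mem_twisted, eq_iff_true_of_subsingleton]
      have h2 : rootPoly F (isEmptyElim : ι → K) = 1 := by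
        apply map_injective _ (algebraMap F K).injective
        rw [map_rootPoly (σ := σ) (by simp [h1])]
        simp
      rw [twistedSum, h1, Finset.sum_singleton, h2, jet_one]
      simp
    · have hd := minimalPeriod_perm_pos σ a
      have hcard : Function.minimalPeriod σ a + Fintype.card {j // ¬ σ.SameCycle a j} = n := by
        have h1 := Fintype.sum_subtype_add_sum_subtype (σ.SameCycle a) fun _ => 1
        rw [sum_sameCycle σ a fun _ => 1] at h1
        simpa [hn] using h1
      obtain ⟨l, hl1, hl2, hl3⟩ := ih _ (by omega) (permCompl σ a) rfl
      refine ⟨Function.minimalPeriod σ a :: l, ?_, ?_, fun k φ => ?_⟩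
      · simpa using ⟨hd, hl1⟩
      · rw [List.sum_cons, hl2, hcard]
      · rw [twistedSum_eq_mul σ φ a, hl3, List.map_cons, List.prod_cons]

variable [IsAlgClosed K] {ι : Type*} [Fintype ι] (σ : Equiv.Perm ι)

lemma card_twisted : (twisted F K σ).card = q ^ Fintype.card ι := by
  obtain ⟨l, hl1, hl2, hl3⟩ := exists_twistedSum_eq_prod F K _ σ rfl
  have h1 := hl3 0 1
  have h2 : l.map (pointSum K (1 : JetGroup F 0 →* ℂ)) = l.map fun d => (q : ℂ) ^ d := by
    refine List.map_congr_left fun d hd => ?_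
    have := hl1 d hd
    simp [pointSum, card_fixed F (K := K) (d := d) (by omega)]
  have h3 : (l.map fun d => (q : ℂ) ^ d).prod = (q : ℂ) ^ l.sum := by
    clear hl1 hl2 hl3 h1 h2
    induction l with
    | nil => simp
    | cons d l ih => rw [List.map_cons, List.prod_cons, ih, List.sum_cons, pow_add]
  rw [h2, h3, hl2] at h1
  simp only [twistedSum, MonoidHom.one_apply, Finset.sum_const, nsmul_eq_mul, mul_one] at h1
  exact_mod_cast h1

variable {F}

lemma norm_twistedSum_le [Algebra.IsAlgebraic F K] {k : ℕ} (hk : 1 ≤ k) {φ : JetGroup F k →* ℂ}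
    (hφ : ∑ g, φ g = 0) :
    ‖twistedSum K φ σ‖ ≤ (k * √q) ^ Fintype.card ι := by
  obtain ⟨l, hl1, hl2, hl3⟩ := exists_twistedSum_eq_prod F K _ σ rfl
  rw [hl3, ← hl2]
  clear hl2 hl3
  induction l with
  | nil => simp
  | cons d l ih =>
    rw [List.map_cons, List.prod_cons, List.sum_cons, pow_add, norm_mul]
    have hd : 1 ≤ d := hl1 d (by simp)
    have hk' : (1 : ℝ) ≤ k := by exact_mod_cast hk
    refine mul_le_mul ((norm_pointSum_le K hφ hd).trans ?_)
      (ih fun d hd => hl1 d (List.mem_cons_of_mem _ hd)) (norm_nonneg _) (by positivity)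
    rw [mul_pow]
    exact mul_le_mul_of_nonneg_right (le_self_pow₀ hk' (by omega)) (by positivity)

end TwistedSum

section Parseval

lemma sum_normSq_charSum {A : Type*} [AddCommGroup A] [Fintype A] (E : A → ℝ) :
    ∑ ψ : AddChar A ℂ, ‖∑ a, (E a : ℂ) * ψ a‖ ^ 2 = Fintype.card A * ∑ a, E a ^ 2 := by
  classical
  have h1 : ∀ ψ : AddChar A ℂ, ((‖∑ a, (E a : ℂ) * ψ a‖ ^ 2 : ℝ) : ℂ) =
      ∑ a, ∑ b, (E a * E b : ℂ) * ψ (a - b) := by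
    intro ψ
    push_cast
    rw [← Complex.mul_conj', map_sum, Finset.sum_mul_sum]
    refine Finset.sum_congr rfl fun a _ => Finset.sum_congr rfl fun b _ => ?_
    rw [map_mul, Complex.conj_ofReal, sub_eq_add_neg, AddChar.map_add_eq_mul,
      AddChar.map_neg_eq_conj]
    ring
  have h2 : ((∑ ψ : AddChar A ℂ, ‖∑ a, (E a : ℂ) * ψ a‖ ^ 2 : ℝ) : ℂ) =
      ((Fintype.card A * ∑ a, E a ^ 2 : ℝ) : ℂ) := by
    rw [Complex.ofReal_sum, Finset.sum_congr rfl fun ψ _ => h1 ψ, Finset.sum_comm]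
    push_cast
    rw [Finset.mul_sum]
    refine Finset.sum_congr rfl fun a _ => ?_
    rw [Finset.sum_comm]
    simp only [← Finset.mul_sum, AddChar.sum_apply_eq_ite, sub_eq_zero]
    simp
    ring
  exact_mod_cast h2

lemma sum_sq_sub_le_of_charSum_le {A : Type*} [AddCommGroup A] [Fintype A] {N : A → ℝ} {c B : ℝ}
    (hc : ∑ a, N a = Fintype.card A * c)
    (h : ∀ ψ : AddChar A ℂ, ψ ≠ 0 → ‖∑ a, (N a : ℂ) * ψ a‖ ≤ B) (hB : 0 ≤ B) :
    ∑ a, (N a - c) ^ 2 ≤ B ^ 2 := by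
  have hA : (0 : ℝ) < Fintype.card A := by exact_mod_cast Fintype.card_pos
  have h1 : ∀ ψ : AddChar A ℂ, ‖∑ a, ((N a - c : ℝ) : ℂ) * ψ a‖ ^ 2 ≤ B ^ 2 := by
    intro ψ
    refine pow_le_pow_left₀ (norm_nonneg _) ?_ 2
    by_cases hψ : ψ = 0
    · subst hψ
      have : ∑ a, ((N a - c : ℝ) : ℂ) * (0 : AddChar A ℂ) a = 0 := by
        simp only [AddChar.zero_apply, mul_one, ← Complex.ofReal_sum]
        rw [Finset.sum_sub_distrib, hc]
        simp
      rw [this, norm_zero]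
      exact hB
    · have h0 : ∑ a, ψ a = 0 := AddChar.sum_eq_zero_iff_ne_zero.2 hψ
      have : ∑ a, ((N a - c : ℝ) : ℂ) * ψ a = ∑ a, (N a : ℂ) * ψ a := by
        push_cast
        simp only [sub_mul, Finset.sum_sub_distrib, ← Finset.mul_sum, h0]
        ring
      rw [this]
      exact h ψ hψ
  have h2 := Finset.sum_le_sum fun ψ (_ : ψ ∈ (Finset.univ : Finset (AddChar A ℂ))) => h1 ψ
  rw [sum_normSq_charSum, Finset.sum_const, Finset.card_univ, AddChar.card_eq, nsmul_eq_mul] at h2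
  exact le_of_mul_le_mul_left h2 hA

lemma sum_sq_sub_le {G : Type*} [CommGroup G] [Fintype G] {N : G → ℝ} {c B : ℝ}
    (hc : ∑ g, N g = Fintype.card G * c)
    (h : ∀ φ : G →* ℂ, ∑ g, φ g = 0 → ‖∑ g, (N g : ℂ) * φ g‖ ≤ B) (hB : 0 ≤ B) :
    ∑ g, (N g - c) ^ 2 ≤ B ^ 2 := by
  have hc' : ∑ a : Additive G, N a.toMul = Fintype.card (Additive G) * c := by
    rw [Equiv.sum_comp Additive.toMul N, hc, Fintype.card_congr Additive.toMul]
  rw [← Equiv.sum_comp Additive.toMul]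
  refine sum_sq_sub_le_of_charSum_le hc' (fun ψ hψ => ?_) hB
  let φ : G →* ℂ :=
    { toFun := fun g => ψ (Additive.ofMul g)
      map_one' := by simp
      map_mul' := fun a b => by rw [ofMul_mul, AddChar.map_add_eq_mul] }
  have hφ := h φ ((Equiv.sum_comp Additive.toMul φ).symm.trans
    (AddChar.sum_eq_zero_iff_ne_zero.2 hψ))
  rw [← Equiv.sum_comp Additive.toMul] at hφ
  exact hφ

end Parseval

section Perturbation

lemma exists_abs_prod_one_add_le {ι : Type*} (s : Finset ι) {D : ℝ} (hD : 0 ≤ D) :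
    ∃ C : ℝ, 0 ≤ C ∧ ∀ ε : ι → ℝ, (∀ i ∈ s, |ε i| ≤ D) →
      |∏ i ∈ s, (1 + ε i) - 1 - ∑ i ∈ s, ε i| ≤ C * ∑ i ∈ s, ε i ^ 2 := by
  classical
  induction s using Finset.induction_on with
  | empty => exact ⟨0, le_rfl, fun ε _ => by simp⟩
  | insert a s ha ih =>
    obtain ⟨C, hC, h⟩ := ih
    refine ⟨(1 + D) * C + s.card + 1, by positivity, fun ε hε => ?_⟩
    have h1 := h ε fun i hi => hε i (Finset.mem_insert_of_mem hi)
    rw [Finset.prod_insert ha, Finset.sum_insert ha, Finset.sum_insert ha]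
    set R := ∏ i ∈ s, (1 + ε i) - 1 - ∑ i ∈ s, ε i with hR
    have h2 : (1 + ε a) * ∏ i ∈ s, (1 + ε i) - 1 - (ε a + ∑ i ∈ s, ε i) =
        (1 + ε a) * R + ∑ i ∈ s, ε a * ε i := by
      rw [← Finset.mul_sum, hR]
      ring
    have h3 : |∑ i ∈ s, ε a * ε i| ≤ s.card * ε a ^ 2 + ∑ i ∈ s, ε i ^ 2 := by
      refine (Finset.abs_sum_le_sum_abs _ _).trans ?_
      rw [← nsmul_eq_mul, ← Finset.sum_const, ← Finset.sum_add_distrib]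
      refine Finset.sum_le_sum fun i _ => abs_le.2 ⟨?_, ?_⟩ <;>
        nlinarith [sq_nonneg (ε a - ε i), sq_nonneg (ε a + ε i), sq_nonneg (ε a), sq_nonneg (ε i)]
    have h4 : |1 + ε a| ≤ 1 + D := (abs_add_le _ _).trans
      (by rw [abs_one]; exact add_le_add le_rfl (hε a (Finset.mem_insert_self _ _)))
    have h5 : 0 ≤ ∑ i ∈ s, ε i ^ 2 := Finset.sum_nonneg fun i _ => sq_nonneg _
    rw [h2]
    calc _ ≤ |(1 + ε a) * R| + |∑ i ∈ s, ε a * ε i| := abs_add_le _ _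
      _ ≤ (1 + D) * (C * ∑ i ∈ s, ε i ^ 2) + (s.card * ε a ^ 2 + ∑ i ∈ s, ε i ^ 2) := by
          rw [abs_mul]
          gcongr
      _ ≤ _ := by
          have : 0 ≤ ((1 + D) * C + 1) * ε a ^ 2 := by positivity
          have : 0 ≤ (s.card : ℝ) * ∑ i ∈ s, ε i ^ 2 := by positivity
          linarith

lemma exists_abs_sum_prod_sub_le (ι : Type*) [Fintype ι] (hι : 2 ≤ Fintype.card ι) {D : ℝ}
    (hD : 0 ≤ D) : ∃ C : ℝ, 0 ≤ C ∧ ∀ (G : Type) [Fintype G] (N : ι → G → ℝ) (x : ℝ), 0 < x →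
      (∀ i g, |N i g - x| ≤ D * x) → (∀ i, ∑ g, N i g = Fintype.card G * x) →
      |∑ g, ∏ i, N i g - Fintype.card G * x ^ Fintype.card ι| ≤
        C * x ^ (Fintype.card ι - 2) * ∑ i, ∑ g, (N i g - x) ^ 2 := by
  obtain ⟨C, hC, h⟩ := exists_abs_prod_one_add_le (Finset.univ : Finset ι) hD
  refine ⟨C, hC, fun G _ N x hx hN hsum => ?_⟩
  obtain ⟨m, hm⟩ : ∃ m, Fintype.card ι = m + 2 := ⟨Fintype.card ι - 2, by omega⟩
  have h1 : ∀ g, |∏ i, N i g - x ^ (m + 2) - x ^ (m + 1) * ∑ i, (N i g - x)| ≤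
      C * x ^ m * ∑ i, (N i g - x) ^ 2 := by
    intro g
    have h2 := h (fun i => (N i g - x) / x) fun i _ => by
      rw [abs_div, abs_of_pos hx, div_le_iff₀ hx]
      exact hN i g
    have h3 : ∏ i, N i g = x ^ (m + 2) * ∏ i, (1 + (N i g - x) / x) := by
      rw [← hm, ← Finset.card_univ, ← Finset.prod_const, ← Finset.prod_mul_distrib]
      refine Finset.prod_congr rfl fun i _ => ?_
      field_simp
      ring
    have h4 : x ^ (m + 1) * ∑ i, (N i g - x) = x ^ (m + 2) * ∑ i, (N i g - x) / x := by
      rw [← Finset.sum_div]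
      field_simp
      ring
    have h5 : x ^ m * ∑ i, (N i g - x) ^ 2 = x ^ (m + 2) * ∑ i, ((N i g - x) / x) ^ 2 := by
      simp only [div_pow]
      rw [← Finset.sum_div]
      field_simp
      ring
    rw [mul_assoc C, h5, h3, h4, mul_left_comm]
    calc _ = x ^ (m + 2) * |∏ i, (1 + (N i g - x) / x) - 1 - ∑ i, (N i g - x) / x| := by
          rw [← abs_of_pos (pow_pos hx (m + 2)), ← abs_mul, abs_of_pos (pow_pos hx (m + 2))]
          congr 1
          ring
      _ ≤ _ := mul_le_mul_of_nonneg_left h2 (by positivity)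
  have h6 : ∑ g, ∏ i, N i g - Fintype.card G * x ^ Fintype.card ι =
      ∑ g, (∏ i, N i g - x ^ (m + 2) - x ^ (m + 1) * ∑ i, (N i g - x)) := by
    have h7 : ∑ g, ∑ i, (N i g - x) = 0 := by
      rw [Finset.sum_comm]
      refine Finset.sum_eq_zero fun i _ => ?_
      rw [Finset.sum_sub_distrib, hsum]
      simp
    rw [Finset.sum_sub_distrib, Finset.sum_sub_distrib, ← Finset.mul_sum, h7, hm]
    simp
  rw [h6, hm, Nat.add_sub_cancel, Finset.sum_comm, Finset.mul_sum]
  exact (Finset.abs_sum_le_sum_abs _ _).trans (Finset.sum_le_sum fun g _ => h1 g)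

end Perturbation

section Counting

variable (F K : Type*) [Field F] [Fintype F] [Field K] [Algebra F K]

local notation "q" => Fintype.card F

variable {ι : Type*} [Fintype ι] (σ : Equiv.Perm ι) {k : ℕ}

open Classical in
/-- The number of tuples twisted by `σ` whose polynomial has the given jet. -/
noncomputable def jetCount (g : JetGroup F k) : ℕ :=
  ((twisted F K σ).filter fun z => jet k (rootPoly F z) = g).card

lemma jetCount_le (hk : k ≤ Fintype.card ι) (g : JetGroup F k) :
    jetCount F K σ g ≤ Fintype.card ι ^ Fintype.card ι * q ^ (Fintype.card ι - k) := by
  classical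
  rw [jetCount, ← card_filter_jet hk g]
  refine Finset.card_le_mul_card_image_of_maps_to (f := rootPoly F) ?_ _ ?_
  · intro z hz
    rw [Finset.mem_filter] at hz ⊢
    exact ⟨rootPoly_mem_monics hz.1, hz.2⟩
  · intro f hf
    obtain ⟨hfm, hfd⟩ := mem_monics.1 (Finset.mem_filter.1 hf).1
    have hf0 : f.map (algebraMap F K) ≠ 0 := (hfm.map _).ne_zero
    calc _ ≤ (Fintype.piFinset fun _ : ι => (f.map (algebraMap F K)).roots.toFinset).card := by
          refine Finset.card_le_card fun z hz => ?_
          rw [Finset.mem_filter, Finset.mem_filter] at hz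
          rw [Fintype.mem_piFinset]
          intro j
          rw [Multiset.mem_toFinset, mem_roots hf0, ← hz.2, map_rootPoly hz.1.1, IsRoot, eval_prod]
          exact Finset.prod_eq_zero (Finset.mem_univ j) (by simp)
      _ = (f.map (algebraMap F K)).roots.toFinset.card ^ Fintype.card ι := by simp
      _ ≤ _ := by
          refine Nat.pow_le_pow_left ((Multiset.toFinset_card_le _).trans ?_) _
          refine (card_roots' _).trans ?_
          rw [natDegree_map, hfd]

lemma sum_jetCount_mul (φ : JetGroup F k →* ℂ) :
    ∑ g, (jetCount F K σ g : ℂ) * φ g = twistedSum K φ σ := by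
  classical
  rw [twistedSum, ← Finset.sum_fiberwise (twisted F K σ) fun z => jet k (rootPoly F z)]
  refine Finset.sum_congr rfl fun g _ => ?_
  rw [Finset.sum_congr rfl (g := fun _ => φ g) (fun a ha => by rw [(Finset.mem_filter.1 ha).2])]
  simp [jetCount]

variable [IsAlgClosed K]

lemma sum_jetCount : ∑ g : JetGroup F k, jetCount F K σ g = q ^ Fintype.card ι := by
  classical
  rw [← card_twisted F K σ]
  exact (Finset.card_eq_sum_card_fiberwise (by simp)).symm

lemma sum_sq_jetCount_sub_le [Algebra.IsAlgebraic F K] (hk1 : 1 ≤ k) (hk : k ≤ Fintype.card ι) :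
    ∑ g : JetGroup F k, ((jetCount F K σ g : ℝ) - q ^ (Fintype.card ι - k)) ^ 2 ≤
      k ^ (2 * Fintype.card ι) * q ^ Fintype.card ι := by
  have h := sum_sq_sub_le (G := JetGroup F k) (N := fun g => (jetCount F K σ g : ℝ))
    (c := q ^ (Fintype.card ι - k)) (B := (k * √q) ^ Fintype.card ι) ?_ (fun φ hφ => ?_)
    (by positivity)
  · refine h.trans (le_of_eq ?_)
    rw [← pow_mul, mul_comm _ 2, pow_mul, mul_pow, Real.sq_sqrt (by positivity), mul_pow, ← pow_mul]
  · rw [card_jetGroup, ← Nat.cast_sum, sum_jetCount]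
    push_cast
    rw [← pow_add, Nat.add_sub_cancel' hk]
  · simp only [Complex.ofReal_natCast]
    rw [sum_jetCount_mul]
    exact norm_twistedSum_le K σ hk1 hφ

end Counting

section Cone

variable {F K : Type*} [Field F] [Fintype F] [Field K] [Algebra F K]
  {ι : Type*} [Fintype ι] {k : ℕ}

lemma coeff_reverse_rootPoly {σ : Equiv.Perm ι} {z : ι → K} (hz : z ∈ twisted F K σ) {j : ℕ}
    (hj : j ≤ Fintype.card ι) : algebraMap F K ((rootPoly F z).reverse.coeff j) =
      (-1) ^ j * (Finset.univ.val.map z).esymm j := by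
  have h1 : ∏ j, (X - C (z j)) = ((Finset.univ.val.map z).map fun t => X - C t).prod := by
    rw [Multiset.map_map]
    rfl
  have h2 : Multiset.card (Finset.univ.val.map z) = Fintype.card ι := by simp
  rw [coeff_reverse, (mem_monics.1 (rootPoly_mem_monics hz)).2, revAt_le hj, ← coeff_map,
    map_rootPoly hz, h1, Multiset.prod_X_sub_C_coeff _ (by rw [h2]; omega), h2,
    show Fintype.card ι - (Fintype.card ι - j) = j by omega]

lemma jet_rootPoly_eq_iff {σ τ : Equiv.Perm ι} {z w : ι → K} (hz : z ∈ twisted F K σ)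
    (hw : w ∈ twisted F K τ) (hk : k ≤ Fintype.card ι) :
    jet k (rootPoly F z) = jet k (rootPoly F w) ↔ ∀ j, 1 ≤ j → j ≤ k →
      (Finset.univ.val.map z).esymm j = (Finset.univ.val.map w).esymm j := by
  rw [jet_eq_iff (mem_monics.1 (rootPoly_mem_monics hz)).1
    (mem_monics.1 (rootPoly_mem_monics hw)).1]
  have key : ∀ j ≤ k, (rootPoly F z).reverse.coeff j = (rootPoly F w).reverse.coeff j ↔
      (Finset.univ.val.map z).esymm j = (Finset.univ.val.map w).esymm j := by
    intro j hj
    rw [← (algebraMap F K).injective.eq_iff, coeff_reverse_rootPoly hz (hj.trans hk),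
      coeff_reverse_rootPoly hw (hj.trans hk)]
    exact mul_right_inj' (pow_ne_zero _ (neg_ne_zero.2 one_ne_zero))
  refine ⟨fun h j _ hj => (key j hj).1 (h j hj), fun h j hj => (key j hj).2 ?_⟩
  rcases Nat.eq_zero_or_pos j with rfl | hj0
  · simp [Multiset.esymm]
  · exact h j hj0 hj

/-- The points of the cone on which the `q`-power map acts by permuting the coordinates. -/
def conePoints (F K : Type*) [Field F] [Fintype F] [Field K] {m n : ℕ} (k : ℕ) (i₀ : Fin m)
    (σ : Fin m → Equiv.Perm (Fin n)) : Set (Fin m → Fin n → K) :=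
  {z | (∀ i, i ≠ i₀ → ∀ j : ℕ, 1 ≤ j → j ≤ k →
      (Finset.univ.val.map (z i₀)).esymm j = (Finset.univ.val.map (z i)).esymm j) ∧
    ∀ i j, z i j ^ Fintype.card F = z i (σ i j)}

lemma conePoints_finite_and_ncard {m n : ℕ} (hk : k ≤ n) (i₀ : Fin m)
    (σ : Fin m → Equiv.Perm (Fin n)) : (conePoints F K k i₀ σ).Finite ∧
      (conePoints F K k i₀ σ).ncard = ∑ g : JetGroup F k, ∏ i, jetCount F K (σ i) g := by
  classical
  have h1 : conePoints F K k i₀ σ = ((Fintype.piFinset fun i => twisted F K (σ i)).filter fun z =>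
      ∀ i, jet k (rootPoly F (z i)) = jet k (rootPoly F (z i₀)) : Finset (Fin m → Fin n → K)) := by
    ext z
    rw [Finset.mem_coe, Finset.mem_filter, Fintype.mem_piFinset, conePoints, Set.mem_ofPred_eq,
      and_comm]
    have h2 : (∀ i j, z i j ^ Fintype.card F = z i (σ i j)) ↔ ∀ i, z i ∈ twisted F K (σ i) :=
      forall_congr' fun i => mem_twisted.symm
    rw [h2, and_congr_right_iff]
    intro hz
    refine forall_congr' fun i => ?_
    rw [eq_comm, jet_rootPoly_eq_iff (hz i₀) (hz i) (by simpa using hk)]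
    refine ⟨fun h => ?_, fun h _ => h⟩
    by_cases hi : i = i₀
    · subst hi
      exact fun _ _ _ => rfl
    · exact h hi
  refine ⟨h1 ▸ Finset.finite_toSet _, ?_⟩
  rw [h1, Set.ncard_coe_finset,
    Finset.card_eq_sum_card_fiberwise (f := fun z => jet k (rootPoly F (z i₀))) (t := Finset.univ)
      (by simp)]
  refine Finset.sum_congr rfl fun g _ => ?_
  simp only [jetCount]
  rw [← Fintype.card_piFinset]
  congr 1
  ext z
  simp only [Finset.mem_filter, Fintype.mem_piFinset]
  constructor
  · rintro ⟨⟨hz, h⟩, hg⟩ i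
    exact ⟨hz i, (h i).trans hg⟩
  · intro h
    exact ⟨⟨fun i => (h i).1, fun i => (h i).2.trans (h i₀).2.symm⟩, (h i₀).2⟩

end Cone

end ShortIntervalCone

open ShortIntervalCone

/-- Fix `m ≥ 2`, `n ≥ 4`, `1 ≤ h ≤ n - 3` and permutations
`σ 0, …, σ (m-1)` of `{1, …, n}`. There is a constant `C > 0` such that for every finite
field `F` with `q` elements (of characteristic `> n` when `m > 2`) and every algebraic
closure `K` of `F`, the set of tuples `(z i j) ∈ K^{mn}` with
`e_n^j(z 0 •) = e_n^j(z i •)` for all `i ≠ 0`, `1 ≤ j ≤ n - h - 1`, and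
`(z i j) ^ q = z i (σ i j)` for all `i, j` is finite of cardinality `N` satisfying
`|N - q ^ (n + (m-1)(h+1))| ≤ C * q ^ (n + (m-2)(h+1))`. -/
theorem card_frobenius_points_coneShortIntervals (m n h : ℕ) (hm : 2 ≤ m) (hn : 4 ≤ n)
    (hh1 : 1 ≤ h) (hh2 : h ≤ n - 3) (σ : Fin m → Equiv.Perm (Fin n)) :
    ∃ C : ℝ, 0 < C ∧ ∀ (F : Type) [Field F] [Fintype F], (2 < m → n < ringChar F) →
      ∀ (K : Type) [Field K] [Algebra F K], IsAlgClosure F K →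
      {z : Fin m → Fin n → K |
          (∀ i : Fin m, i ≠ ⟨0, by omega⟩ → ∀ j : ℕ, 1 ≤ j → j ≤ n - h - 1 →
            (Finset.univ.val.map (z ⟨0, by omega⟩)).esymm j =
              (Finset.univ.val.map (z i)).esymm j) ∧
          ∀ (i : Fin m) (j : Fin n), z i j ^ Fintype.card F = z i (σ i j)}.Finite ∧
      |(Set.ncard {z : Fin m → Fin n → K |
          (∀ i : Fin m, i ≠ ⟨0, by omega⟩ → ∀ j : ℕ, 1 ≤ j → j ≤ n - h - 1 →
            (Finset.univ.val.map (z ⟨0, by omega⟩)).esymm j =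
              (Finset.univ.val.map (z i)).esymm j) ∧
          ∀ (i : Fin m) (j : Fin n), z i j ^ Fintype.card F = z i (σ i j)} : ℝ) -
        (Fintype.card F : ℝ) ^ (n + (m - 1) * (h + 1))| ≤
      C * (Fintype.card F : ℝ) ^ (n + (m - 2) * (h + 1)) := by
  obtain ⟨C, hC, hbound⟩ := exists_abs_sum_prod_sub_le (Fin m) (by simpa using hm)
    (D := (n : ℝ) ^ n) (by positivity)
  obtain ⟨k, hk⟩ : ∃ k, n = k + (h + 1) := ⟨n - (h + 1), by omega⟩
  have hk1 : n - h - 1 = k := by omega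
  rw [hk1]
  refine ⟨C * (m * k ^ (2 * n)) + 1, by positivity, fun F _ _ _ K _ _ hK => ?_⟩
  have := IsAlgClosure.isAlgClosed F (K := K)
  have : Algebra.IsAlgebraic F K := IsAlgClosure.isAlgebraic
  obtain ⟨hfin, hcard⟩ := conePoints_finite_and_ncard (F := F) (K := K) (k := k) (n := n)
    (by omega) ⟨0, by omega⟩ σ
  refine ⟨hfin, ?_⟩
  change |((conePoints F K k ⟨0, by omega⟩ σ).ncard : ℝ) - _| ≤ _
  rw [hcard]
  set q : ℝ := (Fintype.card F : ℝ) with hq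
  have hq0 : 0 < q := by
    rw [hq]
    exact_mod_cast Fintype.card_pos
  have hnk : n - k = h + 1 := by omega
  have h1 := hbound (JetGroup F k) (fun i g => (jetCount F K (σ i) g : ℝ)) (q ^ (h + 1))
    (by positivity) ?_ ?_
  · have h2 : ∑ i, ∑ g : JetGroup F k, ((jetCount F K (σ i) g : ℝ) - q ^ (h + 1)) ^ 2 ≤
        m * (k ^ (2 * n) * q ^ n) := by
      calc _ ≤ ∑ i : Fin m, (k ^ (2 * n) * q ^ n : ℝ) := by
            refine Finset.sum_le_sum fun i _ => ?_
            have := sum_sq_jetCount_sub_le F K (σ i) (k := k) (by omega) (by simp; omega)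
            rwa [Fintype.card_fin, hnk] at this
        _ = _ := by simp
    rw [card_jetGroup, Fintype.card_fin] at h1
    have h3 : ((Fintype.card F ^ k : ℕ) : ℝ) * (q ^ (h + 1)) ^ m =
        q ^ (n + (m - 1) * (h + 1)) := by
      obtain ⟨m, rfl⟩ : ∃ l, m = l + 1 := ⟨m - 1, by omega⟩
      push_cast
      rw [← hq, ← pow_mul, ← pow_add]
      congr 1
      rw [hk]
      ring
    rw [h3] at h1
    push_cast
    refine h1.trans ?_
    calc _ ≤ C * (q ^ (h + 1)) ^ (m - 2) * (m * (k ^ (2 * n) * q ^ n)) := by gcongr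
      _ = C * (m * k ^ (2 * n)) * q ^ (n + (m - 2) * (h + 1)) := by
          rw [← pow_mul, pow_add, mul_comm (h + 1)]
          ring
      _ ≤ _ := by
          gcongr
          linarith
  · intro i g
    have h2 := jetCount_le F K (σ i) (k := k) (by simp; omega) g
    rw [Fintype.card_fin, hnk] at h2
    have h3 : (jetCount F K (σ i) g : ℝ) ≤ n ^ n * q ^ (h + 1) := by
      rw [hq]
      exact_mod_cast h2
    have h4 : (1 : ℝ) ≤ n ^ n := one_le_pow₀ (by exact_mod_cast (by omega : 1 ≤ n))
    have h5 : 0 < q ^ (h + 1) := by positivity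
    have h6 : (0 : ℝ) ≤ jetCount F K (σ i) g := by positivity
    rw [abs_le]
    constructor <;> nlinarith
  · intro i
    have h2 := sum_jetCount F K (σ i) (k := k)
    rw [Fintype.card_fin] at h2
    rw [← Nat.cast_sum, h2, card_jetGroup]
    push_cast
    rw [← hq, ← pow_add, ← hk]
end
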